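/- arXiv:2603.03086 — 4 statements merged into one kernel-verified Lean document; each statement's English description precedes it below -/
import Mathlib

section
/- Let m be a real number with 1 < m < 2. If a finite simple graph G is (m,0)-sparse, then there exists an edge-partition E(G) = E(F) ∪ E(G′) such that F is (1,−1)-sparse (i.e., a forest) and G′ is (m, 1−2m)-sparse. -/
/-- A finite simple graph `G` is `(a,b)`-sparse if every subgraph `H` of `G`
containing at least one edge satisfies `e(H) ≤ a * v(H) + b`. -/
def IsSparse {V : Type*} [Fintype V] (G : SimpleGraph V) (a b : ℝ) : Prop :=
  ∀ H : G.Subgraph, H.edgeSet.Nonempty →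
    (H.edgeSet.ncard : ℝ) ≤ a * H.verts.ncard + b

/-- `G` admits an edge-partition `E(G) = E(G₁) ∪ E(G₂)` (disjointly) with `G₁`
being `(a₁,b₁)`-sparse and `G₂` being `(a₂,b₂)`-sparse. -/
def HasSparsePartition {V : Type*} [Fintype V] (G : SimpleGraph V)
    (a₁ b₁ a₂ b₂ : ℝ) : Prop :=
  ∃ G₁ G₂ : SimpleGraph V, G₁ ≤ G ∧ G₂ ≤ G ∧
    G₁.edgeSet ∪ G₂.edgeSet = G.edgeSet ∧ Disjoint G₁.edgeSet G₂.edgeSet ∧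
    IsSparse G₁ a₁ b₁ ∧ IsSparse G₂ a₂ b₂

namespace SparsePartition

section Partition

variable {α : Type*} [DecidableEq α]

/-- Every set `R` satisfying the rank condition relative to already chosen `I`, `J` can be
distributed between `I` and `J` so that both end up independent. -/
theorem exists_extension {r s : Finset α → ℕ}
    (hr : ∀ A B, r (A ∪ B) + r (A ∩ B) ≤ r A + r B)
    (hs : ∀ A B, s (A ∪ B) + s (A ∩ B) ≤ s A + s B)
    (hrc : ∀ A, r A ≤ A.card) (hsc : ∀ A, s A ≤ A.card) (R I J : Finset α)
    (hIJ : Disjoint I J) (hRI : Disjoint R I) (hRJ : Disjoint R J)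
    (h : ∀ A ⊆ R, A.card + I.card + J.card ≤ r (A ∪ I) + s (A ∪ J)) :
    ∃ I' J' : Finset α, I' ∪ J' = R ∪ I ∪ J ∧ Disjoint I' J' ∧
      I'.card ≤ r I' ∧ J'.card ≤ s J' := by
  induction R using Finset.induction_on generalizing I J with
  | empty =>
    have h0 := h ∅ subset_rfl
    have h1 := hrc I
    have h2 := hsc J
    simp only [Finset.card_empty, Finset.empty_union] at h0
    exact ⟨I, J, by simp, hIJ, by omega, by omega⟩
  | insert e R he ih =>
    rw [Finset.disjoint_insert_left] at hRI hRJ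
    by_cases h1 : ∀ A ⊆ R, A.card + (insert e I).card + J.card ≤ r (A ∪ insert e I) + s (A ∪ J)
    · obtain ⟨I', J', h', h''⟩ := ih (insert e I) J
        (Finset.disjoint_insert_left.2 ⟨hRJ.1, hIJ⟩)
        (Finset.disjoint_insert_right.2 ⟨he, hRI.2⟩) hRJ.2 h1
      exact ⟨I', J', by rw [h']; ext; simp, h''⟩
    by_cases h2 : ∀ A ⊆ R, A.card + I.card + (insert e J).card ≤ r (A ∪ I) + s (A ∪ insert e J)
    · obtain ⟨I', J', h', h''⟩ := ih I (insert e J)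
        (Finset.disjoint_insert_right.2 ⟨hRI.1, hIJ⟩) hRI.2
        (Finset.disjoint_insert_right.2 ⟨he, hRJ.2⟩) h2
      exact ⟨I', J', by rw [h']; ext; simp, h''⟩
    exfalso
    push Not at h1 h2
    obtain ⟨A, hA, h1⟩ := h1
    obtain ⟨B, hB, h2⟩ := h2
    rw [Finset.card_insert_of_notMem hRI.1] at h1
    rw [Finset.card_insert_of_notMem hRJ.1] at h2
    have heA : e ∉ A := fun h => he (hA h)
    have heB : e ∉ B := fun h => he (hB h)
    have r1 := hr (A ∪ insert e I) (B ∪ I)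
    have s1 := hs (A ∪ J) (B ∪ insert e J)
    have e1 : (A ∪ insert e I) ∪ (B ∪ I) = insert e (A ∪ B) ∪ I := by ext; simp; tauto
    have e2 : (A ∪ insert e I) ∩ (B ∪ I) = (A ∩ B) ∪ I := by
      have := hRI.1
      ext x; by_cases hx : x = e <;> simp_all; tauto
    have e3 : (A ∪ J) ∪ (B ∪ insert e J) = insert e (A ∪ B) ∪ J := by ext; simp; tauto
    have e4 : (A ∪ J) ∩ (B ∪ insert e J) = (A ∩ B) ∪ J := by
      have := hRJ.1
      ext x; by_cases hx : x = e <;> simp_all; tauto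
    rw [e1, e2] at r1
    rw [e3, e4] at s1
    have c1 := h (insert e (A ∪ B)) (Finset.insert_subset_insert _ (Finset.union_subset hA hB))
    have c2 := h (A ∩ B) ((Finset.inter_subset_left.trans hA).trans (Finset.subset_insert _ _))
    rw [Finset.card_insert_of_notMem (by simp [heA, heB])] at c1
    have c3 := Finset.card_union_add_card_inter A B
    omega

/-- The matroid union theorem, for submodular functions bounded by the cardinality. -/
theorem exists_partition {r s : Finset α → ℕ}
    (hr : ∀ A B, r (A ∪ B) + r (A ∩ B) ≤ r A + r B)
    (hs : ∀ A B, s (A ∪ B) + s (A ∩ B) ≤ s A + s B)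
    (hrc : ∀ A, r A ≤ A.card) (hsc : ∀ A, s A ≤ A.card) (E : Finset α)
    (h : ∀ A ⊆ E, A.card ≤ r A + s A) :
    ∃ I J : Finset α, I ∪ J = E ∧ Disjoint I J ∧ I.card ≤ r I ∧ J.card ≤ s J := by
  simpa using exists_extension hr hs hrc hsc E ∅ ∅ (by simp) (by simp) (by simp)
    (by simpa using h)

theorem card_le_of_subset {r : Finset α → ℕ}
    (hr : ∀ A B, r (A ∪ B) + r (A ∩ B) ≤ r A + r B) (hrc : ∀ A, r A ≤ A.card)
    {I B : Finset α} (hI : I.card ≤ r I) (hB : B ⊆ I) : B.card ≤ r B := by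
  have h1 := hr B (I \ B)
  rw [Finset.union_sdiff_of_subset hB] at h1
  have h2 := hrc (I \ B)
  have h3 := Finset.card_sdiff_add_card_eq_card hB
  omega

end Partition

theorem add_self_eq_zero_of_zmod_two {V : Type*} (f : V → ZMod 2) : f + f = 0 :=
  funext fun _ => CharTwo.add_self_eq_zero _

section Edges

variable {V : Type*} [DecidableEq V]

/-- The set of vertices covered by a set of edges. -/
def edgeVerts (A : Finset (Sym2 V)) : Finset V := A.biUnion Sym2.toFinset

theorem mem_edgeVerts {A : Finset (Sym2 V)} {v : V} : v ∈ edgeVerts A ↔ ∃ e ∈ A, v ∈ e := by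
  simp [edgeVerts]

theorem edgeVerts_mono {A B : Finset (Sym2 V)} (h : A ⊆ B) : edgeVerts A ⊆ edgeVerts B :=
  Finset.biUnion_subset_biUnion_of_subset_left _ h

theorem edgeVerts_subset_iff {A : Finset (Sym2 V)} {X : Finset V} :
    edgeVerts A ⊆ X ↔ A ⊆ X.sym2 := by
  simp only [edgeVerts, Finset.biUnion_subset]
  refine forall₂_congr fun e _ => ?_
  rw [Finset.mem_sym2_iff]
  simp [Finset.subset_iff]

theorem edgeVerts_union (A B : Finset (Sym2 V)) :
    edgeVerts (A ∪ B) = edgeVerts A ∪ edgeVerts B := by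
  simp [edgeVerts, Finset.union_biUnion]

theorem two_le_card_edgeVerts {A : Finset (Sym2 V)} (hA : A.Nonempty)
    (h : ∀ e ∈ A, ¬ e.IsDiag) : 2 ≤ (edgeVerts A).card := by
  obtain ⟨e, he⟩ := hA
  have h1 : e.toFinset ⊆ edgeVerts A := Finset.subset_biUnion_of_mem Sym2.toFinset he
  have := Finset.card_le_card h1
  rwa [Sym2.card_toFinset_of_not_isDiag _ (h e he)] at this

/-- The number of non-loop edges on a vertex set. -/
theorem card_le_choose_two {A : Finset (Sym2 V)} (h : ∀ e ∈ A, ¬ e.IsDiag) {X : Finset V}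
    (hX : edgeVerts A ⊆ X) : A.card ≤ X.card.choose 2 := by
  rw [← Sym2.card_image_offDiag]
  refine Finset.card_le_card fun e he => ?_
  have h2 := edgeVerts_subset_iff.1 hX he
  have h3 := h e he
  induction e with | _ x y
  rw [Finset.mk_mem_sym2_iff] at h2
  exact Finset.mem_image.2 ⟨(x, y), by simp [h2, by simpa using h3], rfl⟩

/-- Rank function of the bicircular matroid: the truncation of `A ↦ #(edgeVerts A)` by the
cardinality. -/
def pseudoforestRank (A : Finset (Sym2 V)) : ℕ :=
  A.powerset.inf' ⟨∅, by simp⟩ fun B => (A \ B).card + (edgeVerts B).card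

theorem pseudoforestRank_le {A B : Finset (Sym2 V)} (h : B ⊆ A) :
    pseudoforestRank A ≤ (A \ B).card + (edgeVerts B).card :=
  Finset.inf'_le (fun B => (A \ B).card + (edgeVerts B).card) (Finset.mem_powerset.2 h)

theorem exists_pseudoforestRank_eq (A : Finset (Sym2 V)) :
    ∃ B ⊆ A, pseudoforestRank A = (A \ B).card + (edgeVerts B).card := by
  obtain ⟨B, hB, h⟩ := Finset.exists_mem_eq_inf' (s := A.powerset) ⟨∅, by simp⟩
    fun B => (A \ B).card + (edgeVerts B).card
  exact ⟨B, Finset.mem_powerset.1 hB, h⟩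

theorem pseudoforestRank_le_card (A : Finset (Sym2 V)) : pseudoforestRank A ≤ A.card := by
  simpa [edgeVerts] using pseudoforestRank_le (Finset.empty_subset A)

theorem pseudoforestRank_submodular (A B : Finset (Sym2 V)) :
    pseudoforestRank (A ∪ B) + pseudoforestRank (A ∩ B) ≤
      pseudoforestRank A + pseudoforestRank B := by
  obtain ⟨C, hC, hAC⟩ := exists_pseudoforestRank_eq A
  obtain ⟨D, hD, hBD⟩ := exists_pseudoforestRank_eq B
  have h1 := pseudoforestRank_le (Finset.union_subset_union hC hD)
  have h2 := pseudoforestRank_le (Finset.inter_subset_inter hC hD)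
  have h3 := Finset.card_union_add_card_inter (edgeVerts C) (edgeVerts D)
  rw [← edgeVerts_union] at h3
  have h4 : (edgeVerts (C ∩ D)).card ≤ (edgeVerts C ∩ edgeVerts D).card :=
    Finset.card_le_card (Finset.subset_inter (edgeVerts_mono Finset.inter_subset_left)
      (edgeVerts_mono Finset.inter_subset_right))
  have h5 := Finset.card_union_add_card_inter A B
  have h6 := Finset.card_union_add_card_inter C D
  have h7 := Finset.card_sdiff_add_card_eq_card (Finset.union_subset_union hC hD)
  have h8 := Finset.card_sdiff_add_card_eq_card (Finset.inter_subset_inter hC hD)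
  have h9 := Finset.card_sdiff_add_card_eq_card hC
  have h10 := Finset.card_sdiff_add_card_eq_card hD
  omega

theorem card_le_card_edgeVerts {J B : Finset (Sym2 V)} (hJ : J.card ≤ pseudoforestRank J)
    (hB : B ⊆ J) : B.card ≤ (edgeVerts B).card := by
  have h1 := pseudoforestRank_le hB
  have h2 := Finset.card_sdiff_add_card_eq_card hB
  omega

/-- The column of an edge in the vertex-edge incidence matrix over `ZMod 2`. -/
def incVec : Sym2 V → V → ZMod 2 :=
  Sym2.lift ⟨fun x y => Pi.single x 1 + Pi.single y 1, fun _ _ => add_comm _ _⟩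

theorem incVec_mk (x y : V) : incVec s(x, y) = Pi.single x 1 + Pi.single y 1 := rfl

theorem incVec_self (x : V) : incVec s(x, x) = 0 :=
  add_self_eq_zero_of_zmod_two _

theorem incVec_add_incVec (x y z : V) : incVec s(x, z) + incVec s(y, z) = incVec s(x, y) := by
  simp only [incVec_mk]
  rw [add_add_add_comm, add_self_eq_zero_of_zmod_two, add_zero]

/-- Rank function of the graphic matroid. -/
noncomputable def forestRank (A : Finset (Sym2 V)) : ℕ :=
  Module.finrank (ZMod 2) (Submodule.span (ZMod 2) (incVec '' (A : Set (Sym2 V))))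

theorem forestRank_le_card (A : Finset (Sym2 V)) : forestRank A ≤ A.card := by
  classical
  have h := finrank_span_finset_le_card (R := ZMod 2) (A.image incVec)
  rw [Finset.coe_image] at h
  exact h.trans Finset.card_image_le

variable [Fintype V]

theorem forestRank_mono {A B : Finset (Sym2 V)} (h : A ⊆ B) : forestRank A ≤ forestRank B :=
  Submodule.finrank_mono (Submodule.span_mono (Set.image_mono (by exact_mod_cast h)))

theorem forestRank_submodular (A B : Finset (Sym2 V)) :
    forestRank (A ∪ B) + forestRank (A ∩ B) ≤ forestRank A + forestRank B := by
  unfold forestRank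
  rw [← Submodule.finrank_sup_add_finrank_inf_eq (Submodule.span _ (incVec '' (A : Set (Sym2 V)))),
    ← Submodule.span_union, ← Set.image_union, ← Finset.coe_union]
  have h : Submodule.span (ZMod 2) (incVec '' ((A ∩ B : Finset (Sym2 V)) : Set (Sym2 V))) ≤
      Submodule.span (ZMod 2) (incVec '' (A : Set (Sym2 V))) ⊓
        Submodule.span (ZMod 2) (incVec '' (B : Set (Sym2 V))) :=
    le_inf (Submodule.span_mono (Set.image_mono (by simp)))
      (Submodule.span_mono (Set.image_mono (by simp)))
  exact Nat.add_le_add_left (Submodule.finrank_mono h) _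

theorem forestRank_lt_card_edgeVerts {A : Finset (Sym2 V)} (hA : A.Nonempty) :
    forestRank A < (edgeVerts A).card := by
  obtain ⟨e, he⟩ := hA
  obtain ⟨v, hv⟩ : ∃ v, v ∈ edgeVerts A := by
    induction e with | _ x y
    exact ⟨x, mem_edgeVerts.2 ⟨_, he, by simp⟩⟩
  have h1 : forestRank A ≤ (((edgeVerts A).erase v).image fun x => incVec s(x, v)).card := by
    refine le_trans (Submodule.finrank_mono ?_) (finrank_span_finset_le_card (R := ZMod 2) _)
    rw [Submodule.span_le]
    have key : ∀ x ∈ edgeVerts A, incVec s(x, v) ∈ Submodule.span (ZMod 2)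
        ((((edgeVerts A).erase v).image fun x => incVec s(x, v) : Finset _) : Set (V → ZMod 2)) := by
      intro x hx
      by_cases hxv : x = v
      · rw [hxv, incVec_self]
        exact zero_mem _
      · exact Submodule.subset_span (Finset.mem_coe.2 (Finset.mem_image_of_mem _
          (Finset.mem_erase.2 ⟨hxv, hx⟩)))
    rintro _ ⟨f, hf, rfl⟩
    induction f with | _ x y
    rw [← incVec_add_incVec x y v]
    exact add_mem (key x (mem_edgeVerts.2 ⟨_, hf, by simp⟩))
      (key y (mem_edgeVerts.2 ⟨_, hf, by simp⟩))
  have h2 := Finset.card_image_le (s := (edgeVerts A).erase v) (f := fun x => incVec s(x, v))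
  have h3 := Finset.card_erase_add_one hv
  omega

/-- The connected components of `A`, as the fibres of a map `q`; their number is bounded in terms
of the rank. -/
theorem exists_component_map (A : Finset (Sym2 V)) : ∃ q : V → V,
    (∀ x y, s(x, y) ∈ A → q x = q y) ∧
      Fintype.card V ≤ forestRank A + (Finset.univ.image q).card := by
  let W := Submodule.span (ZMod 2) (incVec '' (A : Set (Sym2 V)))
  let S : Setoid V :=
    { r := fun x y => incVec s(x, y) ∈ W
      iseqv :=
        { refl := fun x => by
            rw [incVec_self]
            exact zero_mem _
          symm := fun {x y} h => by rwa [Sym2.eq_swap]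
          trans := fun {x y z} h h' => by
            rw [← incVec_add_incVec x z y, Sym2.eq_swap (a := z)]
            exact add_mem h h' } }
  have hq : ∀ x, incVec s(x, (Quotient.mk S x).out) ∈ W := fun x => S.symm (Quotient.mk_out x)
  refine ⟨fun x => (Quotient.mk S x).out, fun x y h => ?_, ?_⟩
  · exact congrArg Quotient.out (Quotient.sound (s := S) (Submodule.subset_span ⟨_, h, rfl⟩))
  · set q : V → V := fun x => (Quotient.mk S x).out
    let T : Finset (V → ZMod 2) := (Finset.univ.image q).image fun x => Pi.single x 1
    have htop : W ⊔ Submodule.span (ZMod 2) (T : Set (V → ZMod 2)) = ⊤ := by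
      rw [eq_top_iff, ← (Pi.basisFun (ZMod 2) V).span_eq, Submodule.span_le]
      rintro _ ⟨x, rfl⟩
      have h1 : (Pi.single (q x) 1 : V → ZMod 2) ∈
          Submodule.span (ZMod 2) (T : Set (V → ZMod 2)) :=
        Submodule.subset_span (by simp [T])
      have h2 := add_mem (Submodule.mem_sup_left (hq x)) (Submodule.mem_sup_right (S := W) h1)
      rw [incVec_mk, add_assoc, add_self_eq_zero_of_zmod_two, add_zero] at h2
      simpa using h2
    have h1 := Submodule.finrank_add_le_finrank_add_finrank W
      (Submodule.span (ZMod 2) (T : Set (V → ZMod 2)))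
    rw [htop, finrank_top, Module.finrank_pi] at h1
    have h2 : Module.finrank (ZMod 2) (Submodule.span (ZMod 2) (T : Set (V → ZMod 2))) ≤ T.card :=
      finrank_span_finset_le_card (R := ZMod 2) T
    have h3 : T.card ≤ (Finset.univ.image q).card := Finset.card_image_le
    change _ ≤ Module.finrank (ZMod 2) W + _
    omega

/-- If every component of `A`, with edge set `B` and vertex set `X`, has at most `#X - 1 + g X`
edges, then `A` has at most `forestRank A + ∑ g X` edges. -/
theorem card_le_forestRank_add {A : Finset (Sym2 V)} {q : V → V}
    (hq : ∀ x y, s(x, y) ∈ A → q x = q y)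
    (hcard : Fintype.card V ≤ forestRank A + (Finset.univ.image q).card) (g : V → ℕ)
    (hg : ∀ B ⊆ A, ∀ c ∈ Finset.univ.image q, edgeVerts B ⊆ Finset.univ.filter (q · = c) →
      B.card + 1 ≤ (Finset.univ.filter (q · = c)).card + g c) :
    A.card ≤ forestRank A + ∑ c ∈ Finset.univ.image q, g c := by
  let f : Sym2 V → V := fun e => q (Quot.out e).1
  have hf : ∀ e ∈ A, ∀ x ∈ e, q x = f e := by
    intro e he x hx
    have h0 : s((Quot.out e).1, (Quot.out e).2) = e := Quot.out_eq e
    rw [← h0, Sym2.mem_iff] at hx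
    rw [← h0] at he
    rcases hx with rfl | rfl
    · rfl
    · exact (hq _ _ he).symm
  have h1 : A.card = ∑ c ∈ Finset.univ.image q, (A.filter (f · = c)).card :=
    Finset.card_eq_sum_card_fiberwise fun e _ => by simp [f]
  have h2 : Fintype.card V =
      ∑ c ∈ Finset.univ.image q, (Finset.univ.filter (q · = c)).card :=
    Finset.card_eq_sum_card_fiberwise fun e _ => by simp
  have h3 := Finset.sum_le_sum fun c hc => hg (A.filter (f · = c)) (Finset.filter_subset _ _) c hc
    fun x hx => by
      obtain ⟨e, he, hx⟩ := mem_edgeVerts.1 hx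
      rw [Finset.mem_filter] at he
      simpa [← he.2] using hf e he.1 x hx
  rw [Finset.sum_add_distrib, Finset.sum_add_distrib, ← h1, ← h2, Finset.sum_const, smul_eq_mul,
    mul_one] at h3
  omega

theorem card_le_forestRank_add_forestRank {A : Finset (Sym2 V)}
    (h : ∀ B ⊆ A, B.Nonempty → B.card + 2 ≤ 2 * (edgeVerts B).card) :
    A.card ≤ forestRank A + forestRank A := by
  obtain ⟨q, hq, hcard⟩ := exists_component_map A
  have hpos : ∀ c ∈ Finset.univ.image q, 1 ≤ (Finset.univ.filter (q · = c)).card := by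
    intro c hc
    obtain ⟨x, -, hx⟩ := Finset.mem_image.1 hc
    exact Finset.card_pos.2 ⟨x, by simpa using hx⟩
  have h1 := card_le_forestRank_add hq hcard
    (fun c => (Finset.univ.filter (q · = c)).card - 1) fun B hB c hc hBc => by
      have h2 := hpos c hc
      rcases B.eq_empty_or_nonempty with rfl | hne
      · simp; omega
      · have h3 := h B hB hne
        have h4 := Finset.card_le_card hBc
        omega
  have h2 : Fintype.card V =
      ∑ c ∈ Finset.univ.image q, (Finset.univ.filter (q · = c)).card :=
    Finset.card_eq_sum_card_fiberwise fun e _ => by simp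
  have h3 : ∑ c ∈ Finset.univ.image q, ((Finset.univ.filter (q · = c)).card - 1) +
      (Finset.univ.image q).card = Fintype.card V := by
    rw [h2, Finset.card_eq_sum_ones, ← Finset.sum_add_distrib]
    exact Finset.sum_congr rfl fun c hc => Nat.sub_add_cancel (hpos c hc)
  omega

theorem card_le_forestRank_add_pseudoforestRank {A : Finset (Sym2 V)}
    (h : ∀ B ⊆ A, B.Nonempty → B.card + 1 ≤ 2 * (edgeVerts B).card) :
    A.card ≤ forestRank A + pseudoforestRank A := by
  obtain ⟨C, hC, hAC⟩ := exists_pseudoforestRank_eq A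
  obtain ⟨q, hq, hcard⟩ := exists_component_map C
  have h1 := card_le_forestRank_add hq hcard
    (fun c => ((edgeVerts C).filter (q · = c)).card) fun B hB c hc hBc => by
      rcases B.eq_empty_or_nonempty with rfl | hne
      · obtain ⟨x, -, hx⟩ := Finset.mem_image.1 hc
        have : 1 ≤ (Finset.univ.filter (q · = c)).card :=
          Finset.card_pos.2 ⟨x, by simpa using hx⟩
        simp; omega
      · have h3 := h B (hB.trans hC) hne
        have h4 := Finset.card_le_card hBc
        have h5 : (edgeVerts B).card ≤ ((edgeVerts C).filter (q · = c)).card :=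
          Finset.card_le_card fun x hx => Finset.mem_filter.2
            ⟨edgeVerts_mono hB hx, (Finset.mem_filter.1 (hBc hx)).2⟩
        omega
  have h2 : (edgeVerts C).card =
      ∑ c ∈ Finset.univ.image q, ((edgeVerts C).filter (q · = c)).card :=
    Finset.card_eq_sum_card_fiberwise fun e _ => by simp
  have h3 := forestRank_mono hC
  have h4 := Finset.card_sdiff_add_card_eq_card hC
  omega

end Edges

section Exchange

variable {V : Type*} [DecidableEq V]

theorem linearIndepOn_of_card_le_forestRank {I : Finset (Sym2 V)} (h : I.card ≤ forestRank I) :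
    LinearIndepOn (ZMod 2) incVec (I : Set (Sym2 V)) := by
  have h1 : Set.range (fun e : (I : Set (Sym2 V)) => incVec (e : Sym2 V)) =
      incVec '' (I : Set (Sym2 V)) := (Set.image_eq_range _ _).symm
  refine linearIndependent_iff_card_eq_finrank_span.2 ?_
  rw [h1]
  change _ = forestRank I
  simpa using le_antisymm h (forestRank_le_card I)

theorem card_le_forestRank_of_linearIndepOn {I : Finset (Sym2 V)}
    (h : LinearIndepOn (ZMod 2) incVec (I : Set (Sym2 V))) : I.card ≤ forestRank I := by
  have h1 : Set.range (fun e : (I : Set (Sym2 V)) => incVec (e : Sym2 V)) =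
      incVec '' (I : Set (Sym2 V)) := (Set.image_eq_range _ _).symm
  have h2 := linearIndependent_iff_card_eq_finrank_span.1 h
  rw [h1] at h2
  change _ = forestRank I at h2
  simpa using h2.le

/-- Fundamental circuits: if `insert e I` is dependent, then `v e` is a combination of `v '' I`, and
every element occurring in it can be exchanged for `e`. -/
theorem exists_fundamental_circuit {ι K M : Type*} [DecidableEq ι] [Field K] [AddCommGroup M]
    [Module K M] {v : ι → M} {I : Finset ι} (hI : LinearIndepOn K v (I : Set ι)) {e : ι}
    (he : ¬ LinearIndepOn K v (insert e I : Finset ι)) :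
    ∃ c : ι → K, ∑ f ∈ I, c f • v f = v e ∧
      ∀ f ∈ I, c f ≠ 0 → LinearIndepOn K v (insert e (I.erase f) : Finset ι) := by
  have h1 : v e ∈ Submodule.span K (v '' (I : Set ι)) := by
    by_contra h
    rw [Finset.coe_insert] at he
    exact he (hI.insert h)
  obtain ⟨c, hc⟩ := (Submodule.mem_span_image_finset_iff_exists_fun K).1 h1
  let c' : ι → K := fun f => if hf : f ∈ I then c ⟨f, hf⟩ else 0
  have hc' : ∑ f ∈ I, c' f • v f = v e := by
    rw [← hc, ← Finset.sum_attach, Finset.univ_eq_attach]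
    exact Finset.sum_congr rfl fun f _ => by simp [c']
  refine ⟨c', hc', fun f hf hcf => ?_⟩
  rw [Finset.coe_insert, Finset.coe_erase]
  refine (hI.mono Set.sdiff_subset).insert fun h2 => ?_
  refine linearIndepOn_iff_notMem_span.1 hI f hf ?_
  rw [← Finset.add_sum_erase _ _ hf] at hc'
  have h3 : ∑ g ∈ I.erase f, c' g • v g ∈ Submodule.span K (v '' ((I : Set ι) \ {f})) :=
    Submodule.sum_mem _ fun g hg => Submodule.smul_mem _ _ (Submodule.subset_span
      ⟨g, by simpa [and_comm] using hg, rfl⟩)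
  rw [← Submodule.smul_mem_iff _ hcf, eq_sub_of_add_eq hc']
  exact sub_mem h2 h3

/-- If the path joining two vertices of `A` in a forest has no edge leaving `A`, then it lies
in `A`. -/
theorem mem_of_coeff_ne_zero {I : Finset (Sym2 V)}
    (hI : LinearIndepOn (ZMod 2) incVec (I : Set (Sym2 V))) {c : Sym2 V → ZMod 2} {a b : V}
    (hc : ∑ f ∈ I, c f • incVec f = incVec s(a, b)) {A : Finset V} (ha : a ∈ A) (hb : b ∈ A)
    (h : ∀ x y, s(x, y) ∈ I → c s(x, y) ≠ 0 → x ∈ A → y ∈ A) {x y : V} (hxy : s(x, y) ∈ I)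
    (hcxy : c s(x, y) ≠ 0) : x ∈ A := by
  let d : Sym2 V → ZMod 2 := fun f => if f ∈ A.sym2 then c f else 0
  have h1 : ∑ f ∈ I, d f • incVec f = incVec s(a, b) := by
    funext z
    by_cases hz : z ∈ A
    · rw [← hc, Finset.sum_apply, Finset.sum_apply]
      refine Finset.sum_congr rfl fun f hf => ?_
      induction f with | _ x y
      by_cases hxyA : s(x, y) ∈ A.sym2
      · simp only [d, hxyA, if_true]
      · by_cases hcf : c s(x, y) = 0
        · simp [d, hcf]
        · have h2 := h x y hf hcf
          have h3 := h y x (by rwa [Sym2.eq_swap]) (by rwa [Sym2.eq_swap])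
          rw [Finset.mk_mem_sym2_iff] at hxyA
          have hx : x ∉ A := by tauto
          have hy : y ∉ A := by tauto
          have hzx : z ≠ x := fun h => hx (h ▸ hz)
          have hzy : z ≠ y := fun h => hy (h ▸ hz)
          simp [incVec_mk, hzx, hzy]
    · have hza : z ≠ a := fun h => hz (h ▸ ha)
      have hzb : z ≠ b := fun h => hz (h ▸ hb)
      rw [Finset.sum_apply]
      simp only [incVec_mk, Pi.add_apply, Pi.single_apply, hza, hzb, if_false, add_zero]
      refine Finset.sum_eq_zero fun f hf => ?_
      induction f with | _ x y
      by_cases hxyA : s(x, y) ∈ A.sym2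
      · rw [Finset.mk_mem_sym2_iff] at hxyA
        have hzx : z ≠ x := fun h => hz (h ▸ hxyA.1)
        have hzy : z ≠ y := fun h => hz (h ▸ hxyA.2)
        simp [incVec_mk, hzx, hzy]
      · simp only [d, hxyA, if_false, zero_smul, Pi.zero_apply]
  have h2 := linearIndepOn_finset_iff.1 hI (fun f => c f - d f) (by
    simp only [sub_smul, Finset.sum_sub_distrib, h1, hc, sub_self]) _ hxy
  by_contra hx
  apply hcxy
  simpa [d, hx] using h2

/-- The sum of the coordinates in `S`. -/
theorem sum_incVec_mk (S : Finset V) (x y : V) :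
    ∑ z ∈ S, incVec s(x, y) z = (if x ∈ S then 1 else 0) + if y ∈ S then 1 else 0 := by
  simp [incVec_mk, Finset.sum_add_distrib, Pi.single_apply]

/-- Let each `A i` contain exactly two vertices of a triangle, and let no vertex lie in all three
sets. Then one of the edges of the triangle can be added to the forest `I`, possibly after deletion
of an edge leaving the corresponding set. -/
theorem exists_exchange {I : Finset (Sym2 V)}
    (hI : LinearIndepOn (ZMod 2) incVec (I : Set (Sym2 V))) {t : Fin 3 → V} {A : Fin 3 → Finset V}
    (htA : ∀ i j, t j ∈ A i ↔ j ≠ i) (hA : ∀ z, ∃ i, z ∉ A i) :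
    ∃ i : Fin 3, LinearIndepOn (ZMod 2) incVec
        ((insert s(t (i + 1), t (i + 2)) I : Finset (Sym2 V)) : Set (Sym2 V)) ∨
      ∃ x y : V, s(x, y) ∈ I ∧ x ∈ A i ∧ y ∉ A i ∧ LinearIndepOn (ZMod 2) incVec
        ((insert s(t (i + 1), t (i + 2)) (I.erase s(x, y)) : Finset (Sym2 V)) :
          Set (Sym2 V)) := by
  by_contra! hcon
  choose c hc hc' using fun i => exists_fundamental_circuit hI (hcon i).1
  have hmem : ∀ i x y, s(x, y) ∈ I → c i s(x, y) ≠ 0 → x ∈ A i := by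
    intro i x y hxy hcxy
    refine mem_of_coeff_ne_zero hI (hc i) ((htA _ _).2 ?_) ((htA _ _).2 ?_) ?_ hxy hcxy
    · clear hcxy
      revert i
      decide
    · clear hcxy
      revert i
      decide
    · intro x y hxy hcxy hx
      by_contra hy
      exact (hcon i).2 x y hxy hx hy (hc' i _ hxy hcxy)
  have hmem' : ∀ i x y, s(x, y) ∈ I → c i s(x, y) ≠ 0 → y ∈ A i := by
    intro i x y hxy hcxy
    rw [Sym2.eq_swap] at hxy hcxy
    exact hmem i y x hxy hcxy
  have hsum : ∀ f ∈ I, c 0 f + c 1 f + c 2 f = 0 := by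
    refine linearIndepOn_finset_iff.1 hI (fun f => c 0 f + c 1 f + c 2 f) ?_
    simp only [add_smul, Finset.sum_add_distrib, hc]
    change incVec s(t 1, t 2) + incVec s(t 2, t 0) + incVec s(t 0, t 1) = 0
    rw [add_comm (incVec s(t 1, t 2)), Sym2.eq_swap (a := t 2), incVec_add_incVec,
      add_self_eq_zero_of_zmod_two]
  have h1 : ∑ z ∈ A 1, ∑ f ∈ I, c 0 f * incVec f z = 1 := by
    have h2 : ∀ z, ∑ f ∈ I, c 0 f * incVec f z = incVec s(t 1, t 2) z := by
      intro z
      have := congrFun (hc 0) z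
      simpa [Finset.sum_apply] using this
    simp only [h2, sum_incVec_mk, htA]
    decide
  rw [Finset.sum_comm] at h1
  refine zero_ne_one ((Finset.sum_eq_zero fun f hf => ?_).symm.trans h1)
  rw [← Finset.mul_sum]
  induction f with | _ x y
  by_cases h0 : c 0 s(x, y) = 0
  · rw [h0, zero_mul]
  rw [sum_incVec_mk]
  by_cases h2 : c 1 s(x, y) = 0
  · have h3 : c 2 s(x, y) ≠ 0 := fun h3 => h0 (by simpa [h2, h3] using hsum _ hf)
    have hnot : ∀ z, z ∈ A 0 → z ∈ A 2 → z ∉ A 1 := by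
      intro z z0 z2 z1
      obtain ⟨i, hi⟩ := hA z
      fin_cases i <;> contradiction
    rw [if_neg (hnot x (hmem _ _ _ hf h0) (hmem _ _ _ hf h3)),
      if_neg (hnot y (hmem' _ _ _ hf h0) (hmem' _ _ _ hf h3)), add_zero, mul_zero]
  · rw [if_pos (hmem _ _ _ hf h2), if_pos (hmem' _ _ _ hf h2), CharTwo.add_self_eq_zero, mul_zero]

end Exchange

section Unicyclic

variable {V : Type*}

theorem injective_of_triangle {J : Finset (Sym2 V)} (hJ : ∀ e ∈ J, ¬ e.IsDiag) {t : Fin 3 → V}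
    (ht : ∀ i, s(t (i + 1), t (i + 2)) ∈ J) : Function.Injective t := by
  have h0 := hJ _ (ht 0)
  have h1 := hJ _ (ht 1)
  have h2 := hJ _ (ht 2)
  have h0' : t 1 ≠ t 2 := by simpa using h0
  have h1' : t 2 ≠ t 0 := by simpa using h1
  have h2' : t 0 ≠ t 1 := by simpa using h2
  intro i j hij
  fin_cases i <;> fin_cases j <;> simp_all

theorem triangle_edge_injective {t : Fin 3 → V} (ht : Function.Injective t) :
    Function.Injective fun i : Fin 3 => s(t (i + 1), t (i + 2)) := by
  intro i j h
  simp only [Sym2.eq_iff, ht.eq_iff] at h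
  revert i j
  decide

/-- The vertices of `X` at even distance from the edge of the triangle opposite to `t i`, after
deletion of that edge. -/
def evenSide (X : Finset V) (l : V → Fin 3 × Bool) (i : Fin 3) : Finset V :=
  X.filter fun z => (decide ((l z).1 ≠ i) ^^ (l z).2) = true

theorem exists_notMem_evenSide (X : Finset V) (l : V → Fin 3 × Bool) (z : V) :
    ∃ i, z ∉ evenSide X l i := by
  have key : ∀ a : Fin 3 × Bool, ∃ i : Fin 3, (decide (a.1 ≠ i) ^^ a.2) ≠ true := by decide
  obtain ⟨i, hi⟩ := key (l z)
  exact ⟨i, fun h => hi (Finset.mem_filter.1 h).2⟩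

variable [DecidableEq V]

/-- `X` is a connected set of vertices spanning exactly as many edges of the pseudoforest `J` as it
has vertices, and its cycle is the triangle `t`. Each vertex is labelled with the vertex of `t` it
hangs from and with the parity of its distance from that vertex. -/
structure UnicyclicLabelling (J : Finset (Sym2 V)) (t : Fin 3 → V) (X : Finset V)
    (l : V → Fin 3 × Bool) : Prop where
  mem : ∀ i, t i ∈ X
  label : ∀ i, l (t i) = (i, false)
  edge : ∀ x y, s(x, y) ∈ J → x ∈ X → y ∈ X →
    (∃ i j, x = t i ∧ y = t j) ∨ ((l x).1 = (l y).1 ∧ (l x).2 = !(l y).2)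
  sparse : ∀ B ⊆ J, ∀ Y ⊆ X, Y.Nonempty → edgeVerts B ⊆ Y → (∃ i, t i ∉ Y) → B.card + 1 ≤ Y.card
  tight : ∃ B ⊆ J, edgeVerts B ⊆ X ∧ X.card ≤ B.card

theorem UnicyclicLabelling.of_triangle {J : Finset (Sym2 V)} (hJ : ∀ e ∈ J, ¬ e.IsDiag)
    {t : Fin 3 → V} (ht : ∀ i, s(t (i + 1), t (i + 2)) ∈ J) :
    ∃ l, UnicyclicLabelling J t (Finset.univ.image t) l := by
  have hinj := injective_of_triangle hJ ht
  have hcard : (Finset.univ.image t).card = 3 := by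
    rw [Finset.card_image_of_injective _ hinj]; simp
  refine ⟨Function.extend t (fun i => (i, false)) (fun _ => (0, false)),
    fun i => by simp, fun i => hinj.extend_apply _ _ _, fun x y _ hx hy => Or.inl ?_,
    fun B hB Y hY hne hBY ⟨i, hi⟩ => ?_,
    Finset.univ.image fun i : Fin 3 => s(t (i + 1), t (i + 2)), ?_, ?_, ?_⟩
  · obtain ⟨i, -, hi⟩ := Finset.mem_image.1 hx
    obtain ⟨j, -, hj⟩ := Finset.mem_image.1 hy
    exact ⟨i, j, hi.symm, hj.symm⟩
  · have h1 := card_le_choose_two (fun e he => hJ e (hB he)) hBY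
    have h2 : Y.card < 3 := by
      rw [← hcard]
      exact Finset.card_lt_card (Finset.ssubset_iff_subset_ne.2
        ⟨hY, fun h => hi (h ▸ Finset.mem_image_of_mem t (Finset.mem_univ i))⟩)
    have h3 := hne.card_pos
    interval_cases Y.card <;> simp at h1 ⊢ <;> omega
  · exact Finset.image_subset_iff.2 fun i _ => ht i
  · rw [edgeVerts_subset_iff, Finset.image_subset_iff]
    intro i _
    simp
  · rw [hcard, Finset.card_image_of_injective _ (triangle_edge_injective hinj)]
    simp

theorem UnicyclicLabelling.extend {J : Finset (Sym2 V)} (hJ : ∀ e ∈ J, ¬ e.IsDiag)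
    (hJ' : ∀ B ⊆ J, B.card ≤ (edgeVerts B).card) {t : Fin 3 → V} {X : Finset V}
    {l : V → Fin 3 × Bool} (h : UnicyclicLabelling J t X l) {x y : V} (hxy : s(x, y) ∈ J)
    (hx : x ∈ X) (hy : y ∉ X) : ∃ l', UnicyclicLabelling J t (insert y X) l' := by
  have huniq : ∀ z ∈ X, s(z, y) ∈ J → z = x := by
    intro z hz hzy
    by_contra hzx
    obtain ⟨B, hB, hBX, hcard⟩ := h.tight
    have hB1 : ∀ w, s(w, y) ∉ B := fun w hw => hy (hBX (mem_edgeVerts.2 ⟨_, hw, by simp⟩))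
    have h1 := hJ' (insert s(z, y) (insert s(x, y) B))
      (Finset.insert_subset hzy (Finset.insert_subset hxy hB))
    have hne : s(z, y) ≠ s(x, y) := fun h => hzx (Sym2.congr_left.1 h)
    rw [Finset.card_insert_of_notMem (by simp [hne, hB1]),
      Finset.card_insert_of_notMem (hB1 x)] at h1
    have h2 : edgeVerts (insert s(z, y) (insert s(x, y) B)) ⊆ insert y X := by
      rw [edgeVerts_subset_iff] at hBX ⊢
      refine Finset.insert_subset (by simp [hz]) (Finset.insert_subset (by simp [hx]) ?_)
      exact hBX.trans (Finset.sym2_mono (Finset.subset_insert _ _))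
    have h3 := Finset.card_le_card h2
    rw [Finset.card_insert_of_notMem hy] at h3
    omega
  have hyy : s(y, y) ∉ J := fun h => hJ _ h (by simp)
  have hne : ∀ {z}, z ∈ X → z ≠ y := fun hz hzy => hy (hzy ▸ hz)
  refine ⟨Function.update l y ((l x).1, !(l x).2), fun i => Finset.mem_insert_of_mem (h.mem i),
    fun i => ?_, fun a b hab ha hb => ?_, fun B hB Y hY hYne hBY ⟨i, hi⟩ => ?_, ?_⟩
  · rw [Function.update_of_ne (hne (h.mem i)), h.label]
  · rcases Finset.mem_insert.1 ha with ha' | ha' <;> rcases Finset.mem_insert.1 hb with hb' | hb'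
    · rw [ha', hb'] at hab
      exact absurd hab hyy
    · rw [ha', Sym2.eq_swap] at hab
      rw [ha', huniq b hb' hab]
      simp [Function.update_of_ne (hne hx)]
    · rw [hb'] at hab
      rw [hb', huniq a ha' hab]
      simp [Function.update_of_ne (hne hx)]
    · simpa [Function.update_of_ne (hne hb'), Function.update_of_ne (hne ha')] using
        h.edge a b hab ha' hb'
  · by_cases hyY : y ∈ Y
    · have hYX : Y.erase y ⊆ X := Finset.subset_insert_iff.1 hY
      have h1 : edgeVerts (B.erase s(x, y)) ⊆ Y.erase y := by
        intro z hz
        refine Finset.mem_erase.2 ⟨?_, hBY (edgeVerts_mono (Finset.erase_subset _ _) hz)⟩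
        rintro rfl
        obtain ⟨e, he, hze⟩ := mem_edgeVerts.1 hz
        rw [Finset.mem_erase] at he
        obtain ⟨w, rfl⟩ := Sym2.mem_iff_exists.1 hze
        have hw : w ∈ Y := hBY (mem_edgeVerts.2 ⟨_, he.2, by simp⟩)
        have hwz : w ≠ z := by
          rintro rfl
          exact hyy (hB he.2)
        rw [Sym2.eq_swap] at he
        exact he.1 (by rw [huniq w (hYX (Finset.mem_erase.2 ⟨hwz, hw⟩)) (hB he.2)])
      have h2 := Finset.card_erase_add_one hyY
      have h3 := Finset.pred_card_le_card_erase (s := B) (a := s(x, y))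
      rcases (Y.erase y).eq_empty_or_nonempty with h0 | h0
      · have h4 : B = ∅ := by
          rw [Finset.eq_empty_iff_forall_notMem]
          intro e he
          induction e with | _ a b
          have ha : a ∈ Y := hBY (mem_edgeVerts.2 ⟨_, he, by simp⟩)
          have hb : b ∈ Y := hBY (mem_edgeVerts.2 ⟨_, he, by simp⟩)
          rw [Finset.erase_eq_empty_iff] at h0
          rcases h0 with h0 | h0
          · simp [h0] at ha
          · rw [h0, Finset.mem_singleton] at ha hb
            exact hyy (by simpa [ha, hb] using hB he)
        rw [h4, Finset.card_empty]
        omega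
      · have h4 := h.sparse (B.erase s(x, y)) ((Finset.erase_subset _ _).trans hB) _ hYX h0 h1
          ⟨i, fun h => hi (Finset.mem_of_mem_erase h)⟩
        omega
    · refine h.sparse B hB Y ?_ hYne hBY ⟨i, hi⟩
      rwa [Finset.subset_insert_iff_of_notMem hyY] at hY
  · obtain ⟨B, hB, hBX, hcard⟩ := h.tight
    refine ⟨insert s(x, y) B, Finset.insert_subset hxy hB, ?_, ?_⟩
    · rw [edgeVerts_subset_iff] at hBX ⊢
      refine Finset.insert_subset (by simp [hx]) ?_
      exact hBX.trans (Finset.sym2_mono (Finset.subset_insert _ _))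
    · rw [Finset.card_insert_of_notMem hy, Finset.card_insert_of_notMem]
      · omega
      · exact fun hB' => hy (hBX (mem_edgeVerts.2 ⟨_, hB', by simp⟩))

/-- The component of a triangle in a pseudoforest. -/
theorem exists_unicyclicLabelling [Fintype V] {J : Finset (Sym2 V)} (hJ : ∀ e ∈ J, ¬ e.IsDiag)
    (hJ' : ∀ B ⊆ J, B.card ≤ (edgeVerts B).card) {t : Fin 3 → V}
    (ht : ∀ i, s(t (i + 1), t (i + 2)) ∈ J) :
    ∃ X l, UnicyclicLabelling J t X l ∧ ∀ x y, s(x, y) ∈ J → x ∈ X → y ∈ X := by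
  classical
  obtain ⟨X, hX, hmax⟩ := Finset.exists_max_image
    (Finset.univ.filter fun X : Finset V => ∃ l, UnicyclicLabelling J t X l) Finset.card
    ⟨_, by simpa using UnicyclicLabelling.of_triangle hJ ht⟩
  obtain ⟨l, hl⟩ := (Finset.mem_filter.1 hX).2
  refine ⟨X, l, hl, fun x y hxy hx => ?_⟩
  by_contra hy
  have h1 := hmax (insert y X) (by simpa using hl.extend hJ hJ' hxy hx hy)
  rw [Finset.card_insert_of_notMem hy] at h1
  omega

theorem UnicyclicLabelling.mem_evenSide {J : Finset (Sym2 V)} {t : Fin 3 → V} {X : Finset V}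
    {l : V → Fin 3 × Bool} (h : UnicyclicLabelling J t X l) (i j : Fin 3) :
    t j ∈ evenSide X l i ↔ j ≠ i := by
  simp [evenSide, h.mem, h.label]

theorem UnicyclicLabelling.mem_evenSide_iff_of_edge {J : Finset (Sym2 V)} {t : Fin 3 → V}
    {X : Finset V} {l : V → Fin 3 × Bool} (h : UnicyclicLabelling J t X l)
    (hJ : ∀ e ∈ J, ¬ e.IsDiag) (i : Fin 3) {x y : V} (hxy : s(x, y) ∈ J)
    (hne : s(x, y) ≠ s(t (i + 1), t (i + 2))) (hx : x ∈ X) (hy : y ∈ X) :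
    x ∈ evenSide X l i ↔ y ∉ evenSide X l i := by
  rcases h.edge x y hxy hx hy with ⟨a, b, rfl, rfl⟩ | ⟨h1, h2⟩
  · rw [h.mem_evenSide, h.mem_evenSide]
    have key : ∀ i a b : Fin 3, a ≠ b → (a = i + 1 → b ≠ i + 2) → (a = i + 2 → b ≠ i + 1) →
        (a ≠ i ↔ b = i) := by decide
    rw [not_not]
    refine key i a b ?_ ?_ ?_
    · rintro rfl
      exact hJ _ hxy (by simp)
    · rintro rfl rfl
      exact hne rfl
    · rintro rfl rfl
      exact hne Sym2.eq_swap
  · simp only [evenSide, Finset.mem_filter, hx, hy, true_and, h1, h2]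
    cases (l y).2 <;> simp

/-- Adding an edge at `x ∈ X` after deleting an edge of the triangle keeps a pseudoforest. -/
theorem UnicyclicLabelling.card_le_card_edgeVerts {J : Finset (Sym2 V)} {t : Fin 3 → V}
    {X : Finset V} {l : V → Fin 3 × Bool} (h : UnicyclicLabelling J t X l)
    (hJ' : ∀ B ⊆ J, B.card ≤ (edgeVerts B).card)
    (hX : ∀ x y, s(x, y) ∈ J → x ∈ X → y ∈ X) {e f : Sym2 V} (he : e ∈ J)
    (het : ∃ i j, e = s(t i, t j)) {x : V} (hx : x ∈ X) (hxf : x ∈ f) {B : Finset (Sym2 V)}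
    (hB : B ⊆ insert f (J.erase e)) : B.card ≤ (edgeVerts B).card := by
  by_cases hf : f ∈ B
  swap
  · rw [Finset.subset_insert_iff_of_notMem hf] at hB
    exact hJ' B (hB.trans (Finset.erase_subset _ _))
  rw [Finset.subset_insert_iff] at hB
  set C := B.erase f with hC
  have hCJ : C ⊆ J := hB.trans (Finset.erase_subset _ _)
  have hCB : edgeVerts C ⊆ edgeVerts B := edgeVerts_mono (Finset.erase_subset _ _)
  let C₁ := C ∩ X.sym2
  let C₂ := C \ X.sym2
  have h1 : C₁.card + C₂.card = C.card := Finset.card_inter_add_card_sdiff _ _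
  have h2 : C.card + 1 = B.card := Finset.card_erase_add_one hf
  have hxB : x ∈ edgeVerts B := mem_edgeVerts.2 ⟨f, hf, hxf⟩
  have h3 : C₁.card + 1 ≤ (edgeVerts B ∩ X).card := by
    have hC₁ : C₁ ⊆ J := Finset.inter_subset_left.trans hCJ
    have hsub : edgeVerts C₁ ⊆ edgeVerts B ∩ X :=
      Finset.subset_inter ((edgeVerts_mono Finset.inter_subset_left).trans hCB)
        (edgeVerts_subset_iff.2 Finset.inter_subset_right)
    by_cases htri : ∃ i, t i ∉ edgeVerts B ∩ X
    · exact h.sparse C₁ hC₁ _ Finset.inter_subset_right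
        ⟨x, Finset.mem_inter.2 ⟨hxB, hx⟩⟩ hsub htri
    · push Not at htri
      have heC : e ∉ C₁ := fun h =>
        Finset.notMem_erase e J (hB (Finset.mem_inter.1 h).1)
      have h4 := hJ' (insert e C₁) (Finset.insert_subset he hC₁)
      rw [Finset.card_insert_of_notMem heC] at h4
      refine h4.trans (Finset.card_le_card ?_)
      rw [edgeVerts_subset_iff] at hsub ⊢
      refine Finset.insert_subset ?_ hsub
      obtain ⟨i, j, rfl⟩ := het
      exact Finset.mk_mem_sym2_iff.2 ⟨htri i, htri j⟩
  have h4 : C₂.card ≤ (edgeVerts B \ X).card := by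
    refine (hJ' C₂ (Finset.sdiff_subset.trans hCJ)).trans (Finset.card_le_card fun z hz => ?_)
    refine Finset.mem_sdiff.2 ⟨hCB (edgeVerts_mono Finset.sdiff_subset hz), fun hzX => ?_⟩
    obtain ⟨g, hg, hzg⟩ := mem_edgeVerts.1 hz
    rw [Finset.mem_sdiff] at hg
    obtain ⟨w, rfl⟩ := Sym2.mem_iff_exists.1 hzg
    exact hg.2 (Finset.mk_mem_sym2_iff.2 ⟨hzX, hX z w (hCJ hg.1) hzX⟩)
  have h5 : (edgeVerts B ∩ X).card + (edgeVerts B \ X).card = (edgeVerts B).card :=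
    Finset.card_inter_add_card_sdiff _ _
  omega

variable [Fintype V]

/-- The triangles with all edges in `J`, as ordered triples. -/
def triangles (J : Finset (Sym2 V)) : Finset (Fin 3 → V) :=
  Finset.univ.filter fun t => ∀ i, s(t (i + 1), t (i + 2)) ∈ J

theorem mem_triangles {J : Finset (Sym2 V)} {t : Fin 3 → V} :
    t ∈ triangles J ↔ ∀ i, s(t (i + 1), t (i + 2)) ∈ J := by
  simp [triangles]

theorem triangles_ssubset {J J' : Finset (Sym2 V)} {t : Fin 3 → V} (ht : t ∈ triangles J)
    {i : Fin 3} (hi : s(t (i + 1), t (i + 2)) ∉ J') (h : triangles J' ⊆ triangles J) :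
    triangles J' ⊂ triangles J :=
  (Finset.ssubset_iff_of_subset h).2 ⟨t, ht, fun h' => hi (mem_triangles.1 h' i)⟩

/-- Adding an edge whose ends have no common neighbour creates no triangle. -/
theorem triangles_insert_subset {J : Finset (Sym2 V)} {x y : V} (hJ : ∀ e ∈ J, ¬ e.IsDiag)
    (hxy : x ≠ y) (h : ∀ z, s(x, z) ∈ J → s(y, z) ∉ J) :
    triangles (insert s(x, y) J) ⊆ triangles J := by
  intro t ht
  rw [mem_triangles] at ht ⊢
  have hinj := injective_of_triangle (J := insert s(x, y) J)
    (by simpa [hxy] using hJ) ht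
  have hedge := triangle_edge_injective hinj
  intro i
  refine (Finset.mem_insert.1 (ht i)).resolve_left fun hi => ?_
  have key : ∀ i : Fin 3, i + 1 + 1 = i + 2 ∧ i + 1 + 2 = i ∧ i + 2 + 1 = i ∧ i + 2 + 2 = i + 1 ∧
      i + 1 ≠ i ∧ i + 2 ≠ i := by decide
  obtain ⟨k1, k2, k3, k4, k5, k6⟩ := key i
  have h1 := (Finset.mem_insert.1 (ht (i + 1))).resolve_left fun h => k5 (hedge (h.trans hi.symm))
  have h2 := (Finset.mem_insert.1 (ht (i + 2))).resolve_left fun h => k6 (hedge (h.trans hi.symm))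
  rw [k1, k2] at h1
  rw [k3, k4, Sym2.eq_swap] at h2
  rcases Sym2.eq_iff.1 hi with ⟨rfl, rfl⟩ | ⟨rfl, rfl⟩
  · exact h _ h2 h1
  · exact h _ h1 h2

/-- A triangle in the pseudoforest of a partition into a forest and a pseudoforest can be
destroyed without creating another one. -/
theorem exists_fewer_triangles {I J : Finset (Sym2 V)} (hIJ : Disjoint I J)
    (hloop : ∀ e ∈ I ∪ J, ¬ e.IsDiag) (hI : LinearIndepOn (ZMod 2) incVec (I : Set (Sym2 V)))
    (hJ : ∀ B ⊆ J, B.card ≤ (edgeVerts B).card) (hne : (triangles J).Nonempty) :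
    ∃ I' J' : Finset (Sym2 V), I' ∪ J' = I ∪ J ∧ Disjoint I' J' ∧
      LinearIndepOn (ZMod 2) incVec (I' : Set (Sym2 V)) ∧
      (∀ B ⊆ J', B.card ≤ (edgeVerts B).card) ∧ triangles J' ⊂ triangles J := by
  obtain ⟨t, ht⟩ := hne
  have hloopJ : ∀ e ∈ J, ¬ e.IsDiag := fun e he => hloop e (Finset.mem_union_right _ he)
  have ht' := mem_triangles.1 ht
  obtain ⟨X, l, hl, hX⟩ := exists_unicyclicLabelling hloopJ hJ ht'
  have herase : ∀ e, triangles (J.erase e) ⊆ triangles J := fun e s hs =>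
    mem_triangles.2 fun i => Finset.mem_of_mem_erase (mem_triangles.1 hs i)
  obtain ⟨i, hi | ⟨x, y, hxy, hx, hy, hi⟩⟩ :=
    exists_exchange hI (hl.mem_evenSide) (exists_notMem_evenSide X l)
  · refine ⟨_, J.erase s(t (i + 1), t (i + 2)), ?_, ?_, hi,
      fun B hB => hJ B (hB.trans (Finset.erase_subset _ _)),
      triangles_ssubset ht (Finset.notMem_erase _ _) (herase _)⟩
    · rw [Finset.insert_union, ← Finset.union_insert, Finset.insert_erase (ht' i)]
    · rw [Finset.disjoint_insert_left]
      exact ⟨Finset.notMem_erase _ _, hIJ.mono_right (Finset.erase_subset _ _)⟩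
  · set e := s(t (i + 1), t (i + 2)) with he
    have heI : e ∉ I := fun h => Finset.disjoint_left.1 hIJ h (ht' i)
    have hfJ : s(x, y) ∉ J := Finset.disjoint_left.1 hIJ hxy
    have hfe : s(x, y) ≠ e := fun h => heI (h ▸ hxy)
    have hxX : x ∈ X := (Finset.mem_filter.1 hx).1
    refine ⟨_, insert s(x, y) (J.erase e), ?_, ?_, hi, fun B hB =>
      hl.card_le_card_edgeVerts hJ hX (ht' i) ⟨_, _, he⟩ hxX (Sym2.mem_mk_left x y) hB,
      triangles_ssubset ht (i := i) ?_ ((triangles_insert_subset ?_ ?_ ?_).trans (herase e))⟩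
    · have := ht' i
      ext g
      by_cases h1 : g = e <;> by_cases h2 : g = s(x, y) <;> simp_all
    · rw [Finset.disjoint_insert_left, Finset.disjoint_insert_right]
      refine ⟨by simp [hfe.symm], Finset.notMem_erase _ _, ?_⟩
      exact hIJ.mono (Finset.erase_subset _ _) (Finset.erase_subset _ _)
    · rw [← he, Finset.mem_insert, not_or]
      exact ⟨hfe.symm, Finset.notMem_erase _ _⟩
    · exact fun g hg => hloopJ g (Finset.mem_of_mem_erase hg)
    · rintro rfl
      exact hy hx
    · intro z hxz hyz
      rw [Finset.mem_erase] at hxz hyz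
      have hzX := hX x z hxz.2 hxX
      have hyX := hX z y (by rw [Sym2.eq_swap]; exact hyz.2) hzX
      have h1 := hl.mem_evenSide_iff_of_edge hloopJ i hxz.2 hxz.1 hxX hzX
      have h2 := hl.mem_evenSide_iff_of_edge hloopJ i hyz.2 hyz.1 hyX hzX
      tauto

theorem exists_forest_triangleFree {I J : Finset (Sym2 V)} (hIJ : Disjoint I J)
    (hloop : ∀ e ∈ I ∪ J, ¬ e.IsDiag) (hI : LinearIndepOn (ZMod 2) incVec (I : Set (Sym2 V)))
    (hJ : ∀ B ⊆ J, B.card ≤ (edgeVerts B).card) :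
    ∃ I' J' : Finset (Sym2 V), I' ∪ J' = I ∪ J ∧ Disjoint I' J' ∧
      LinearIndepOn (ZMod 2) incVec (I' : Set (Sym2 V)) ∧
      (∀ B ⊆ J', B.card ≤ (edgeVerts B).card) ∧ triangles J' = ∅ := by
  induction hn : (triangles J).card using Nat.strong_induction_on generalizing I J with
  | _ n ih =>
    rcases (triangles J).eq_empty_or_nonempty with h | h
    · exact ⟨I, J, rfl, hIJ, hI, hJ, h⟩
    · obtain ⟨I₁, J₁, h1, h2, h3, h4, h5⟩ := exists_fewer_triangles hIJ hloop hI hJ h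
      obtain ⟨I₂, J₂, h6, h7⟩ := ih _ (hn ▸ Finset.card_lt_card h5) h2 (h1 ▸ hloop) h3 h4 rfl
      exact ⟨I₂, J₂, h6.trans h1, h7⟩

/-- Three edges spanning at most three vertices form a triangle. -/
theorem card_le_two_of_triangles_eq_empty {J B : Finset (Sym2 V)} (hJ : triangles J = ∅)
    (hB : B ⊆ J) (hloop : ∀ e ∈ B, ¬ e.IsDiag) {X : Finset V} (hBX : edgeVerts B ⊆ X)
    (hX : X.card = 3) : B.card ≤ 2 := by
  obtain ⟨a, b, c, hab, hac, hbc, rfl⟩ := Finset.card_eq_three.1 hX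
  have hsub : B ⊆ {s(a, b), s(b, c), s(c, a)} := by
    intro e he
    have h1 := edgeVerts_subset_iff.1 hBX he
    have h2 := hloop e he
    induction e with | _ x y
    simp only [Finset.mk_mem_sym2_iff, Finset.mem_insert, Finset.mem_singleton,
      Sym2.mk_isDiag_iff] at h1 h2
    simp only [Finset.mem_insert, Finset.mem_singleton, Sym2.eq_iff]
    grind
  by_contra hcard
  have h3 := Finset.eq_of_subset_of_card_le hsub (Finset.card_le_three.trans (by omega))
  have h4 : ![c, a, b] ∈ triangles J := by
    rw [mem_triangles]
    intro i
    apply hB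
    rw [h3]
    fin_cases i <;> simp
  simp [hJ] at h4

end Unicyclic

section Sparse

variable {V : Type*} [DecidableEq V] [Fintype V]

theorem card_le_of_isSparse {G : SimpleGraph V} {a b : ℝ} (hG : IsSparse G a b)
    {B : Finset (Sym2 V)} (hB : (B : Set (Sym2 V)) ⊆ G.edgeSet) (hne : B.Nonempty) :
    (B.card : ℝ) ≤ a * (edgeVerts B).card + b := by
  let H : G.Subgraph :=
    { verts := edgeVerts B
      Adj := fun x y => s(x, y) ∈ B
      adj_sub := fun h => hB h
      edge_vert := fun h => mem_edgeVerts.2 ⟨_, h, by simp⟩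
      symm := ⟨fun x y h => by rwa [Sym2.eq_swap]⟩ }
  have hH : H.edgeSet = B := by
    ext e
    induction e with | _ x y
    rfl
  have h := hG H (by rw [hH]; exact hne)
  rw [hH, Set.ncard_coe_finset] at h
  change _ ≤ a * ((edgeVerts B : Set V).ncard : ℝ) + b at h
  rwa [Set.ncard_coe_finset] at h

theorem isSparse_fromEdgeSet {J : Finset (Sym2 V)} {a b : ℝ}
    (h : ∀ B ⊆ J, B.Nonempty → ∀ X, edgeVerts B ⊆ X → (B.card : ℝ) ≤ a * X.card + b) :
    IsSparse (SimpleGraph.fromEdgeSet (J : Set (Sym2 V))) a b := by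
  classical
  intro H hH
  have hHJ : H.edgeSet ⊆ J := by
    refine H.edgeSet_subset.trans ?_
    rw [SimpleGraph.edgeSet_fromEdgeSet]
    exact Set.sdiff_subset
  have h1 := h H.edgeSet.toFinset (by simpa [← Finset.coe_subset] using hHJ) (by simpa using hH)
    H.verts.toFinset fun x hx => by
      obtain ⟨e, he, hxe⟩ := mem_edgeVerts.1 hx
      rw [Set.mem_toFinset] at he ⊢
      exact H.mem_verts_of_mem_edge he hxe
  rwa [← Set.ncard_eq_toFinset_card', ← Set.ncard_eq_toFinset_card'] at h1

theorem hasSparsePartition_of_finset {G : SimpleGraph V} {I J : Finset (Sym2 V)} {a b c d : ℝ}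
    (hG : ((I ∪ J : Finset (Sym2 V)) : Set (Sym2 V)) = G.edgeSet) (hIJ : Disjoint I J)
    (hI : ∀ B ⊆ I, B.Nonempty → ∀ X, edgeVerts B ⊆ X → (B.card : ℝ) ≤ a * X.card + b)
    (hJ : ∀ B ⊆ J, B.Nonempty → ∀ X, edgeVerts B ⊆ X → (B.card : ℝ) ≤ c * X.card + d) :
    HasSparsePartition G a b c d := by
  have hedge : ∀ K ⊆ I ∪ J, (SimpleGraph.fromEdgeSet (K : Set (Sym2 V))).edgeSet = K := by
    intro K hK
    rw [SimpleGraph.edgeSet_fromEdgeSet, sdiff_eq_left, Set.disjoint_left]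
    intro e he hdiag
    refine G.not_isDiag_of_mem_edgeSet ?_ (by simpa using hdiag)
    rw [← hG]
    exact hK he
  have h1 := hedge I Finset.subset_union_left
  have h2 := hedge J Finset.subset_union_right
  refine ⟨_, _, ?_, ?_, ?_, ?_, isSparse_fromEdgeSet hI, isSparse_fromEdgeSet hJ⟩
  · rw [← SimpleGraph.edgeSet_subset_edgeSet, h1, ← hG]
    simp
  · rw [← SimpleGraph.edgeSet_subset_edgeSet, h2, ← hG]
    simp
  · rw [h1, h2, ← hG, Finset.coe_union]
  · rw [h1, h2]
    exact_mod_cast hIJ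

theorem card_add_one_le_of_forest {I B : Finset (Sym2 V)} (hI : I.card ≤ forestRank I)
    (hB : B ⊆ I) (hne : B.Nonempty) {X : Finset V} (hX : edgeVerts B ⊆ X) :
    B.card + 1 ≤ X.card :=
  (Nat.succ_le_succ (card_le_of_subset forestRank_submodular forestRank_le_card hI hB)).trans
    ((forestRank_lt_card_edgeVerts hne).trans_le (Finset.card_le_card hX))

theorem exists_two_forests {E : Finset (Sym2 V)} {m : ℝ} (hm : m < 3 / 2)
    (hloop : ∀ e ∈ E, ¬ e.IsDiag)
    (hE : ∀ B ⊆ E, B.Nonempty → (B.card : ℝ) ≤ m * (edgeVerts B).card) :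
    ∃ I J : Finset (Sym2 V), I ∪ J = E ∧ Disjoint I J ∧
      I.card ≤ forestRank I ∧ J.card ≤ forestRank J := by
  refine exists_partition forestRank_submodular forestRank_submodular forestRank_le_card
    forestRank_le_card E fun A hA => card_le_forestRank_add_forestRank fun B hB hne => ?_
  have h1 := hE B (hB.trans hA) hne
  have h2 := two_le_card_edgeVerts hne fun e he => hloop e (hA (hB he))
  have h3 : (0 : ℝ) < (edgeVerts B).card := by exact_mod_cast (by omega)
  have h4 : (B.card : ℝ) * 2 < 3 * (edgeVerts B).card := by nlinarith
  have h5 : B.card * 2 < 3 * (edgeVerts B).card := by exact_mod_cast h4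
  omega

theorem exists_forest_pseudoforest {E : Finset (Sym2 V)} {m : ℝ} (hm : m < 2)
    (hloop : ∀ e ∈ E, ¬ e.IsDiag)
    (hE : ∀ B ⊆ E, B.Nonempty → (B.card : ℝ) ≤ m * (edgeVerts B).card) :
    ∃ I J : Finset (Sym2 V), I ∪ J = E ∧ Disjoint I J ∧
      I.card ≤ forestRank I ∧ J.card ≤ pseudoforestRank J := by
  refine exists_partition forestRank_submodular pseudoforestRank_submodular forestRank_le_card
    pseudoforestRank_le_card E fun A hA =>
      card_le_forestRank_add_pseudoforestRank fun B hB hne => ?_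
  have h1 := hE B (hB.trans hA) hne
  have h2 := two_le_card_edgeVerts hne fun e he => hloop e (hA (hB he))
  have h3 : (0 : ℝ) < (edgeVerts B).card := by exact_mod_cast (by omega)
  have h4 : (B.card : ℝ) < 2 * (edgeVerts B).card := by nlinarith
  have h5 : B.card < 2 * (edgeVerts B).card := by exact_mod_cast h4
  omega

end Sparse

end SparsePartition

open SparsePartition

theorem stmt11 (m : ℝ) (hm1 : 1 < m) (hm2 : m < 2)
    {V : Type*} [Fintype V] (G : SimpleGraph V)
    (hG : IsSparse G m 0) :
    HasSparsePartition G 1 (-1) m (1 - 2 * m) := by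
  classical
  have hloop : ∀ e ∈ G.edgeFinset, ¬ e.IsDiag := fun e he =>
    G.not_isDiag_of_mem_edgeSet (SimpleGraph.mem_edgeFinset.1 he)
  have hE : ∀ B ⊆ G.edgeFinset, B.Nonempty → (B.card : ℝ) ≤ m * (edgeVerts B).card := by
    intro B hB hne
    have h := card_le_of_isSparse hG (fun e he => SimpleGraph.mem_edgeFinset.1 (hB he)) hne
    rwa [add_zero] at h
  have hforest : ∀ I : Finset (Sym2 V), I.card ≤ forestRank I → ∀ B ⊆ I, B.Nonempty →
      ∀ X, edgeVerts B ⊆ X → (B.card : ℝ) ≤ 1 * X.card + -1 := by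
    intro I hI B hB hne X hX
    have h : (B.card : ℝ) + 1 ≤ X.card := by
      exact_mod_cast card_add_one_le_of_forest hI hB hne hX
    linarith
  rcases lt_or_ge m (3 / 2) with hm | hm
  · obtain ⟨I, J, hIJ, hdisj, hI, hJ⟩ := exists_two_forests hm hloop hE
    refine hasSparsePartition_of_finset (by rw [hIJ, SimpleGraph.coe_edgeFinset]) hdisj
      (hforest I hI) fun B hB hne X hX => ?_
    have h1 := hforest J hJ B hB hne X hX
    have h2 := two_le_card_edgeVerts hne fun e he =>
      hloop e (hIJ ▸ Finset.mem_union_right I (hB he))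
    have h3 : (2 : ℝ) ≤ X.card := by exact_mod_cast h2.trans (Finset.card_le_card hX)
    nlinarith
  · obtain ⟨I₀, J₀, hIJ₀, hdisj₀, hI₀, hJ₀⟩ := exists_forest_pseudoforest hm2 hloop hE
    obtain ⟨I, J, hIJ, hdisj, hI, hJ, htri⟩ := exists_forest_triangleFree hdisj₀ (hIJ₀ ▸ hloop)
      (linearIndepOn_of_card_le_forestRank hI₀) fun B hB => card_le_card_edgeVerts hJ₀ hB
    rw [hIJ₀] at hIJ
    refine hasSparsePartition_of_finset (by rw [hIJ, SimpleGraph.coe_edgeFinset]) hdisj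
      (hforest I (card_le_forestRank_of_linearIndepOn hI)) fun B hB hne X hX => ?_
    have hloopB : ∀ e ∈ B, ¬ e.IsDiag := fun e he =>
      hloop e (hIJ ▸ Finset.mem_union_right I (hB he))
    have h1 := (two_le_card_edgeVerts hne hloopB).trans (Finset.card_le_card hX)
    have h2 := (hJ B hB).trans (Finset.card_le_card hX)
    rcases (by omega : X.card = 2 ∨ X.card = 3 ∨ 4 ≤ X.card) with h | h | h
    · have h3 := card_le_choose_two hloopB hX
      rw [h, Nat.choose_self] at h3
      have h4 : (B.card : ℝ) ≤ 1 := by exact_mod_cast h3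
      rw [h]
      push_cast
      linarith
    · have h3 := card_le_two_of_triangles_eq_empty htri hB hloopB hX h
      have h4 : (B.card : ℝ) ≤ 2 := by exact_mod_cast h3
      rw [h]
      push_cast
      linarith
    · have h3 : (B.card : ℝ) ≤ X.card := by exact_mod_cast h2
      have h4 : (4 : ℝ) ≤ X.card := by exact_mod_cast h
      nlinarith
end

section
/- Let k and s be integers with 1 ≤ s ≤ k−1. If a finite simple graph G is (k+1, −s)-sparse, then there exists an edge-partition E(G) = E(F) ∪ E(G′) such that F is a forest, G′ is (k, 1−s)-sparse, and every subgraph H′ of G′ spanning exactly 2k+1 vertices contains at most (2k+1)k − s edges. -/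
section MatroidUnion

variable {α : Type*} [DecidableEq α]

/-- The defining properties of a matroid rank function on finite sets, with integer values. -/
structure IsRankFunction (r : Finset α → ℤ) : Prop where
  empty : r ∅ = 0
  mono : ∀ ⦃A B⦄, A ⊆ B → r A ≤ r B
  insert_le : ∀ e A, r (insert e A) ≤ r A + 1
  submod : ∀ A B, r (A ∪ B) + r (A ∩ B) ≤ r A + r B

namespace IsRankFunction

/-- Contracting an element of a rank function gives a rank function. -/
theorem contract {r : Finset α → ℤ} (hr : IsRankFunction r) (e : α) :
    IsRankFunction fun A => r (insert e A) - r {e} where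
  empty := by simp
  mono A B h := by
    have := hr.mono (Finset.insert_subset_insert e h)
    simpa using this
  insert_le x A := by
    have := hr.insert_le x (insert e A)
    rw [Finset.insert_comm] at this
    linarith
  submod A B := by
    have := hr.submod (insert e A) (insert e B)
    rw [← Finset.insert_union_distrib, ← Finset.insert_inter_distrib] at this
    linarith

theorem singleton_le {r : Finset α → ℤ} (hr : IsRankFunction r) (e : α) : r {e} ≤ 1 := by
  have := hr.insert_le e ∅
  rw [hr.empty] at this
  simpa using this

theorem singleton_nonneg {r : Finset α → ℤ} (hr : IsRankFunction r) (e : α) : 0 ≤ r {e} := by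
  have := hr.mono (Finset.empty_subset {e})
  rwa [hr.empty] at this

theorem insert_le_add_singleton {r : Finset α → ℤ} (hr : IsRankFunction r) (e : α)
    (A : Finset α) : r (insert e A) ≤ r A + r {e} := by
  have h1 := hr.submod {e} A
  have h2 := hr.mono (Finset.empty_subset ({e} ∩ A))
  rw [hr.empty] at h2
  rw [← Finset.insert_eq] at h1
  linarith

/-- The matroid union theorem for two rank functions. -/
theorem exists_partition {r₁ r₂ : Finset α → ℤ} (h₁ : IsRankFunction r₁)
    (h₂ : IsRankFunction r₂) (E : Finset α) (h : ∀ A ⊆ E, (A.card : ℤ) ≤ r₁ A + r₂ A) :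
    ∃ I₁ I₂ : Finset α, Disjoint I₁ I₂ ∧ I₁ ∪ I₂ = E ∧
      r₁ I₁ = I₁.card ∧ r₂ I₂ = I₂.card := by
  induction E using Finset.induction_on generalizing r₁ r₂ with
  | empty => exact ⟨∅, ∅, by simp, by simp, by simp [h₁.empty], by simp [h₂.empty]⟩
  | insert e E he ih =>
    have heE := h {e} (by simp)
    rw [Finset.card_singleton] at heE
    by_cases hA : r₁ {e} = 1 ∧ ∀ A ⊆ E, (A.card : ℤ) ≤ (r₁ (insert e A) - r₁ {e}) + r₂ A
    · obtain ⟨I₁, I₂, hd, hu, hI₁, hI₂⟩ := ih (h₁.contract e) h₂ hA.2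
      have he₁ : e ∉ I₁ := fun h' => he (hu ▸ Finset.mem_union_left _ h')
      have he₂ : e ∉ I₂ := fun h' => he (hu ▸ Finset.mem_union_right _ h')
      refine ⟨insert e I₁, I₂, by simp [he₂, hd], by rw [Finset.insert_union, hu], ?_, hI₂⟩
      rw [Finset.card_insert_of_notMem he₁]
      push_cast
      linarith [hA.1]
    by_cases hB : r₂ {e} = 1 ∧ ∀ A ⊆ E, (A.card : ℤ) ≤ r₁ A + (r₂ (insert e A) - r₂ {e})
    · obtain ⟨I₁, I₂, hd, hu, hI₁, hI₂⟩ := ih h₁ (h₂.contract e) hB.2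
      have he₁ : e ∉ I₁ := fun h' => he (hu ▸ Finset.mem_union_left _ h')
      have he₂ : e ∉ I₂ := fun h' => he (hu ▸ Finset.mem_union_right _ h')
      refine ⟨I₁, insert e I₂, by simp [he₁, hd], by rw [Finset.union_insert, hu], hI₁, ?_⟩
      rw [Finset.card_insert_of_notMem he₂]
      push_cast
      linarith [hB.1]
    exfalso
    push Not at hA hB
    have hcard : ∀ A ⊆ E, ((insert e A).card : ℤ) = A.card + 1 := fun A hAE => by
      rw [Finset.card_insert_of_notMem fun h' => he (hAE h')]
      push_cast
      rfl
    have b₁ := h₁.singleton_le e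
    have b₂ := h₂.singleton_le e
    have c₁ := h₁.singleton_nonneg e
    have c₂ := h₂.singleton_nonneg e
    by_cases e₁ : r₁ {e} = 1
    · obtain ⟨A, hAE, hA⟩ := hA e₁
      by_cases e₂ : r₂ {e} = 1
      · obtain ⟨B, hBE, hB⟩ := hB e₂
        have s₁ := h₁.submod (insert e A) B
        have s₂ := h₂.submod A (insert e B)
        have heA : e ∉ A := fun h' => he (hAE h')
        have heB : e ∉ B := fun h' => he (hBE h')
        rw [Finset.insert_union, Finset.insert_inter_of_notMem heB] at s₁
        rw [Finset.union_insert, Finset.inter_insert_of_notMem heA] at s₂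
        have k₁ := h (insert e (A ∪ B)) (Finset.insert_subset_insert _
          (Finset.union_subset hAE hBE))
        rw [hcard _ (Finset.union_subset hAE hBE)] at k₁
        have k₂ := h (A ∩ B) ((Finset.inter_subset_left.trans hAE).trans
          (Finset.subset_insert _ _))
        have hc := Finset.card_union_add_card_inter A B
        have hc' : ((A ∪ B).card : ℤ) + (A ∩ B).card = A.card + B.card := by exact_mod_cast hc
        linarith
      · have k := h (insert e A) (Finset.insert_subset_insert _ hAE)
        rw [hcard A hAE] at k
        have := h₂.insert_le_add_singleton e A
        lia
    · obtain ⟨A, hAE, hA⟩ := hB (by lia)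
      have k := h (insert e A) (Finset.insert_subset_insert _ hAE)
      rw [hcard A hAE] at k
      have := h₁.insert_le_add_singleton e A
      lia

end IsRankFunction

/-- The rank function of a matroid, restricted to finite sets. -/
theorem Matroid.isRankFunction_eRk (M : Matroid α) :
    IsRankFunction fun A : Finset α => ((M.eRk (A : Set α)).toNat : ℤ) := by
  have hcoe : ∀ A : Finset α, ((M.eRk (A : Set α)).toNat : ℕ∞) = M.eRk (A : Set α) := fun A =>
    ENat.natCast_toNat (ne_top_of_le_ne_top (by simp) (M.eRk_le_encard (A : Set α)))
  refine ⟨by simp, fun A B hAB => ?_, fun e A => ?_, fun A B => ?_⟩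
  · have := M.eRk_mono (Finset.coe_subset.2 hAB)
    rw [← hcoe A, ← hcoe B] at this
    exact_mod_cast this
  · have := M.eRk_union_le_eRk_add_encard (A : Set α) {e}
    rw [Set.union_singleton, ← Finset.coe_insert, ← hcoe A, ← hcoe (insert e A),
      Set.encard_singleton] at this
    exact_mod_cast this
  · have := M.eRk_inter_add_eRk_union_le (A : Set α) B
    rw [← Finset.coe_inter, ← Finset.coe_union, ← hcoe A, ← hcoe B, ← hcoe (A ∪ B),
      ← hcoe (A ∩ B), add_comm] at this
    exact_mod_cast this

/-- The matroid union theorem: if every subset `A` of the finite set `E` contains independent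
sets of two matroids of total size at least that of `A`, then `E` is the disjoint union of
independent sets of the two matroids. -/
theorem Matroid.exists_indep_partition (M₁ M₂ : Matroid α) (E : Finset α)
    (h : ∀ A ⊆ E, ∃ I₁ ⊆ A, ∃ I₂ ⊆ A, M₁.Indep (I₁ : Set α) ∧ M₂.Indep (I₂ : Set α) ∧
      A.card ≤ I₁.card + I₂.card) :
    ∃ I₁ I₂ : Finset α, Disjoint I₁ I₂ ∧ I₁ ∪ I₂ = E ∧
      M₁.Indep (I₁ : Set α) ∧ M₂.Indep (I₂ : Set α) := by
  have hle : ∀ (M : Matroid α) (I A : Finset α), I ⊆ A → M.Indep (I : Set α) →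
      I.card ≤ (M.eRk (A : Set α)).toNat := fun M I A hIA hI => by
    have := hI.encard_le_eRk_of_subset (Finset.coe_subset.2 hIA)
    have hA : M.eRk (A : Set α) ≠ ⊤ :=
      ne_top_of_le_ne_top (by simp) (M.eRk_le_encard (A : Set α))
    simpa using ENat.toNat_le_toNat this hA
  have hindep : ∀ (M : Matroid α) (I : Finset α),
      ((M.eRk (I : Set α)).toNat : ℤ) = I.card → M.Indep (I : Set α) := fun M I hI => by
    obtain ⟨J, hJ⟩ := M.exists_isBasis' (I : Set α)
    have hJI : J = I := by
      refine ((Finset.finite_toSet I).subset hJ.subset).eq_of_subset_of_encard_le hJ.subset ?_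
      rw [hJ.encard_eq_eRk, Set.encard_coe_eq_coe_finsetCard,
        ← ENat.natCast_toNat (ne_top_of_le_ne_top (by simp) (M.eRk_le_encard (I : Set α)))]
      exact_mod_cast hI.ge
    exact hJI ▸ hJ.indep
  obtain ⟨I₁, I₂, hd, hu, h₁, h₂⟩ :=
    M₁.isRankFunction_eRk.exists_partition M₂.isRankFunction_eRk E fun A hA => by
      obtain ⟨I₁, hI₁, I₂, hI₂, i₁, i₂, hc⟩ := h A hA
      have := hle M₁ I₁ A hI₁ i₁
      have := hle M₂ I₂ A hI₂ i₂
      lia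
  exact ⟨I₁, I₂, hd, hu, hindep _ _ h₁, hindep _ _ h₂⟩

end MatroidUnion

section CountMatroid

variable {V : Type*} [DecidableEq V]

/-- A set `I ⊆ E` of edges is count-independent for `h` when every nonempty vertex set `X` spans at
most `h X` edges of `I`. -/
def CountIndep (E : Finset (Sym2 V)) (h : Finset V → ℤ) (I : Finset (Sym2 V)) : Prop :=
  I ⊆ E ∧ ∀ X : Finset V, X.Nonempty → ((I ∩ X.sym2).card : ℤ) ≤ h X

/-- A nonempty vertex set `X` is tight for `I` when it spans exactly `h X` edges of `I`. -/
def CountTight (h : Finset V → ℤ) (I : Finset (Sym2 V)) (X : Finset V) : Prop :=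
  X.Nonempty ∧ ((I ∩ X.sym2).card : ℤ) = h X

/-- Tight sets with a common vertex have a tight union. -/
def Uncrosses (E : Finset (Sym2 V)) (h : Finset V → ℤ) : Prop :=
  ∀ I, CountIndep E h I → ∀ X Y, CountTight h I X → CountTight h I Y →
    (X ∩ Y).Nonempty → CountTight h I (X ∪ Y)

theorem Finset.sym2_inter (X Y : Finset V) : (X ∩ Y).sym2 = X.sym2 ∩ Y.sym2 := by
  ext e
  simp only [Finset.mem_sym2_iff, Finset.mem_inter]
  exact ⟨fun h => ⟨fun a ha => (h a ha).1, fun a ha => (h a ha).2⟩,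
    fun h a ha => ⟨h.1 a ha, h.2 a ha⟩⟩

theorem Finset.disjoint_sym2 {X Y : Finset V} (h : Disjoint X Y) : Disjoint X.sym2 Y.sym2 := by
  rw [Finset.disjoint_iff_inter_eq_empty] at h ⊢
  rw [← Finset.sym2_inter, h, Finset.sym2_empty]

/-- Counting edges spanned by vertex sets is supermodular. -/
theorem card_inter_sym2_add_le (I : Finset (Sym2 V)) (X Y : Finset V) :
    (I ∩ X.sym2).card + (I ∩ Y.sym2).card ≤
      (I ∩ (X ∪ Y).sym2).card + (I ∩ (X ∩ Y).sym2).card := by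
  rw [← Finset.card_union_add_card_inter, ← Finset.inter_union_distrib_left,
    ← Finset.inter_inter_distrib_left, ← Finset.sym2_inter]
  gcongr
  exact Finset.union_subset (Finset.sym2_mono Finset.subset_union_left)
    (Finset.sym2_mono Finset.subset_union_right)

/-- Edges inside pairwise disjoint vertex sets are counted at most once. -/
theorem sum_card_inter_sym2_le (I : Finset (Sym2 V)) {𝒯 : Finset (Finset V)}
    (h𝒯 : (𝒯 : Set (Finset V)).PairwiseDisjoint id) :
    ∑ T ∈ 𝒯, (I ∩ T.sym2).card ≤ I.card := by
  rw [← Finset.card_biUnion]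
  · exact Finset.card_le_card (Finset.biUnion_subset.2 fun _ _ => Finset.inter_subset_left)
  · intro X hX Y hY hne
    exact (Finset.disjoint_sym2 (h𝒯 hX hY hne)).mono
      Finset.inter_subset_right Finset.inter_subset_right

theorem CountIndep.mono {E I J : Finset (Sym2 V)} {h : Finset V → ℤ} (hJ : CountIndep E h J)
    (hIJ : I ⊆ J) : CountIndep E h I :=
  ⟨hIJ.trans hJ.1, fun X hX => le_trans
    (by exact_mod_cast Finset.card_le_card (Finset.inter_subset_inter_right hIJ)) (hJ.2 X hX)⟩

theorem CountIndep.exists_tight_of_not_insert {E I : Finset (Sym2 V)} {h : Finset V → ℤ}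
    (hI : CountIndep E h I) {e : Sym2 V} (heE : e ∈ E) (he : ¬ CountIndep E h (insert e I)) :
    ∃ X, CountTight h I X ∧ e ∈ X.sym2 := by
  unfold CountIndep at he
  push Not at he
  obtain ⟨X, hX, hlt⟩ := he (Finset.insert_subset heE hI.1)
  have hle := hI.2 X hX
  by_cases heX : e ∈ X.sym2
  · refine ⟨X, ⟨hX, le_antisymm hle ?_⟩, heX⟩
    rw [Finset.insert_inter_of_mem heX] at hlt
    have := Finset.card_insert_le e (I ∩ X.sym2)
    lia
  · rw [Finset.insert_inter_of_notMem heX] at hlt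
    lia

/-- If no edge of `A` can be added to `I`, then the maximal tight sets of `I` bound the
difference between the sizes of `A` and `I`. -/
theorem CountIndep.exists_tight_family [Fintype V] {E I A : Finset (Sym2 V)} {h : Finset V → ℤ}
    (hU : Uncrosses E h) (hI : CountIndep E h I) (hA : A ⊆ E)
    (hmax : ∀ e ∈ A, e ∉ I → ¬ CountIndep E h (insert e I)) :
    ∃ 𝒯 : Finset (Finset V), (𝒯 : Set (Finset V)).PairwiseDisjoint id ∧
      (∀ T ∈ 𝒯, CountTight h I T) ∧
      (A.card : ℤ) - I.card ≤ ∑ T ∈ 𝒯, (((A ∩ T.sym2).card : ℤ) - h T) := by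
  classical
  set 𝒯 : Finset (Finset V) := Finset.univ.filter (Maximal (CountTight h I)) with h𝒯
  have hmem : ∀ T, T ∈ 𝒯 ↔ Maximal (CountTight h I) T := by simp [h𝒯]
  have hdisj : (𝒯 : Set (Finset V)).PairwiseDisjoint id := by
    intro X hX Y hY hne
    have hX := (hmem X).1 hX
    have hY := (hmem Y).1 hY
    by_contra hXY
    have hne' : (X ∩ Y).Nonempty := by
      rwa [Finset.nonempty_iff_ne_empty, Ne, ← Finset.disjoint_iff_inter_eq_empty]
    have hu := hU I hI X Y hX.prop hY.prop hne'
    exact hne ((hX.eq_of_le hu Finset.subset_union_left).trans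
      (hY.eq_of_le hu Finset.subset_union_right).symm)
  have hcover : A \ I ⊆ 𝒯.biUnion fun T => (A \ I) ∩ T.sym2 := by
    intro e he
    have he' := Finset.mem_sdiff.1 he
    obtain ⟨X, hX, heX⟩ := hI.exists_tight_of_not_insert (hA he'.1) (hmax e he'.1 he'.2)
    obtain ⟨T, hXT, hT⟩ := (Set.toFinite {X | CountTight h I X}).exists_le_maximal hX
    simp only [Finset.mem_biUnion, Finset.mem_inter]
    exact ⟨T, (hmem T).2 hT, he, Finset.sym2_mono hXT heX⟩
  have h1 : (A \ I).card ≤ ∑ T ∈ 𝒯, ((A \ I) ∩ T.sym2).card :=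
    (Finset.card_le_card hcover).trans Finset.card_biUnion_le
  have h2 : ∑ T ∈ 𝒯, ((I \ A) ∩ T.sym2).card ≤ (I \ A).card :=
    sum_card_inter_sym2_le _ hdisj
  refine ⟨𝒯, hdisj, fun T hT => ((hmem T).1 hT).prop, ?_⟩
  have h3 : ∑ T ∈ 𝒯, (((A ∩ T.sym2).card : ℤ) - h T) =
      ∑ T ∈ 𝒯, (((A \ I) ∩ T.sym2).card : ℤ) - ∑ T ∈ 𝒯, (((I \ A) ∩ T.sym2).card : ℤ) := by
    rw [← Finset.sum_sub_distrib]
    refine Finset.sum_congr rfl fun T hT => ?_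
    rw [← ((hmem T).1 hT).prop.2]
    have := Finset.card_sdiff_add_card_inter (A ∩ T.sym2) (I ∩ T.sym2)
    have := Finset.card_sdiff_add_card_inter (I ∩ T.sym2) (A ∩ T.sym2)
    have e1 : (A ∩ T.sym2) \ (I ∩ T.sym2) = (A \ I) ∩ T.sym2 := by grind
    have e2 : (I ∩ T.sym2) \ (A ∩ T.sym2) = (I \ A) ∩ T.sym2 := by grind
    have e3 := Finset.inter_comm (A ∩ T.sym2) (I ∩ T.sym2)
    grind
  have h4 := Finset.card_sdiff_add_card_inter A I
  have h5 := Finset.card_sdiff_add_card_inter I A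
  rw [Finset.inter_comm I A] at h5
  rw [h3]
  have h1' : ((A \ I).card : ℤ) ≤ ∑ T ∈ 𝒯, (((A \ I) ∩ T.sym2).card : ℤ) := by exact_mod_cast h1
  have h2' : ∑ T ∈ 𝒯, (((I \ A) ∩ T.sym2).card : ℤ) ≤ ((I \ A).card : ℤ) := by exact_mod_cast h2
  lia

/-- Every edge set contains a count-independent set to which none of its edges can be added. -/
theorem exists_maximal_countIndep {E : Finset (Sym2 V)} {h : Finset V → ℤ}
    (h0 : ∀ X : Finset V, X.Nonempty → 0 ≤ h X) (A : Finset (Sym2 V)) :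
    ∃ I ⊆ A, CountIndep E h I ∧ ∀ e ∈ A, e ∉ I → ¬ CountIndep E h (insert e I) := by
  classical
  obtain ⟨I, hI, hmax⟩ := (A.powerset.filter (CountIndep E h)).exists_max_image Finset.card
    ⟨∅, by simpa [CountIndep] using h0⟩
  simp only [Finset.mem_filter, Finset.mem_powerset] at hI hmax
  refine ⟨I, hI.1, hI.2, fun e heA heI hins => ?_⟩
  have := hmax _ ⟨Finset.insert_subset heA hI.1, hins⟩
  rw [Finset.card_insert_of_notMem heI] at this
  lia

/-- The matroid of count-independent sets. -/
def countMatroid [Fintype V] (E : Finset (Sym2 V)) (h : Finset V → ℤ)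
    (h0 : ∀ X : Finset V, X.Nonempty → 0 ≤ h X) (hU : Uncrosses E h) : Matroid (Sym2 V) :=
  (IndepMatroid.ofFinset (E : Set (Sym2 V)) (CountIndep E h)
    (by simpa [CountIndep] using h0)
    (fun _ _ hJ hIJ => hJ.mono hIJ)
    (fun I J hI hJ hlt => by
      by_contra! hcon
      obtain ⟨𝒯, -, hT, hle⟩ := hI.exists_tight_family hU hJ.1 hcon
      have : ∑ T ∈ 𝒯, (((J ∩ T.sym2).card : ℤ) - h T) ≤ 0 :=
        Finset.sum_nonpos fun T h' => sub_nonpos.2 (hJ.2 T (hT T h').1)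
      lia)
    (fun I hI => Finset.coe_subset.2 hI.1)).matroid

theorem countMatroid_indep [Fintype V] {E : Finset (Sym2 V)} {h : Finset V → ℤ}
    (h0 : ∀ X : Finset V, X.Nonempty → 0 ≤ h X) (hU : Uncrosses E h) (I : Finset (Sym2 V)) :
    (countMatroid E h h0 hU).Indep (I : Set (Sym2 V)) ↔ CountIndep E h I := by
  simp [countMatroid]

end CountMatroid

section SparsePartition

variable {V : Type*}

/-- The count `|X| - 1` defining the graphic matroid. -/
def forestCount (X : Finset V) : ℤ := X.card - 1

/-- The count `k|X| + 1 - s`, lowered by one on sets of `2k + 1` vertices. -/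
def refinedCount (k s : ℤ) (X : Finset V) : ℤ :=
  k * X.card + 1 - s - if (X.card : ℤ) = 2 * k + 1 then 1 else 0

theorem forestCount_nonneg (X : Finset V) (hX : X.Nonempty) : 0 ≤ forestCount X := by
  have := hX.card_pos
  unfold forestCount
  lia

theorem refinedCount_le (k s : ℤ) (X : Finset V) :
    refinedCount k s X ≤ k * X.card + 1 - s := by
  unfold refinedCount
  split_ifs <;> lia

theorem refinedCount_nonneg {k s : ℤ} (hs : 1 ≤ s) (hsk : s ≤ k - 1) (X : Finset V)
    (hX : X.Nonempty) : 0 ≤ refinedCount k s X := by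
  have h1 : (1 : ℤ) ≤ X.card := by exact_mod_cast hX.card_pos
  have h2 : k ≤ k * X.card := le_mul_of_one_le_right (by lia) h1
  unfold refinedCount
  split_ifs <;> lia

variable [DecidableEq V]

theorem two_mul_card_inter_sym2_le {I : Finset (Sym2 V)} (hI : ∀ e ∈ I, ¬ e.IsDiag)
    (X : Finset V) : 2 * ((I ∩ X.sym2).card : ℤ) ≤ X.card * (X.card - 1) := by
  have hsub : I ∩ X.sym2 ⊆ X.offDiag.image Sym2.mk.uncurry := by
    intro e he
    obtain ⟨he, hX⟩ := Finset.mem_inter.1 he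
    have hd := hI e he
    induction e with
    | h a b =>
      rw [Finset.mk_mem_sym2_iff] at hX
      exact Finset.mem_image.2 ⟨(a, b), Finset.mem_offDiag.2 ⟨hX.1, hX.2, by simpa using hd⟩, rfl⟩
  have h1 := Finset.card_le_card hsub
  have h2 := Sym2.two_mul_card_image_offDiag X
  rw [Finset.offDiag_card] at h2
  have h3 : X.card ≤ X.card * X.card := Nat.le_mul_self _
  zify [h3] at h1 h2
  linarith

theorem uncrosses_forestCount (E : Finset (Sym2 V)) : Uncrosses E forestCount := by
  intro I hI X Y hX hY hXY
  have hne : (X ∪ Y).Nonempty := hX.1.mono Finset.subset_union_left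
  refine ⟨hne, le_antisymm (hI.2 _ hne) ?_⟩
  have h1 := card_inter_sym2_add_le I X Y
  have h2 := hI.2 _ hXY
  have h3 := hX.2
  have h4 := hY.2
  have h5 := Finset.card_union_add_card_inter X Y
  unfold forestCount at *
  lia

theorem uncrosses_refinedCount {k s : ℤ} (hsk : s ≤ k - 1) {E : Finset (Sym2 V)}
    (hE : ∀ e ∈ E, ¬ e.IsDiag) : Uncrosses E (refinedCount k s) := by
  intro I hI X Y hX hY hXY
  by_cases hsub : X ⊆ Y
  · rwa [Finset.union_eq_right.2 hsub]
  by_cases hsub' : Y ⊆ X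
  · rwa [Finset.union_eq_left.2 hsub']
  have hne : (X ∪ Y).Nonempty := hX.1.mono Finset.subset_union_left
  refine ⟨hne, le_antisymm (hI.2 _ hne) ((refinedCount_le k s _).trans ?_)⟩
  have h1 : ((I ∩ X.sym2).card : ℤ) + (I ∩ Y.sym2).card ≤
      (I ∩ (X ∪ Y).sym2).card + (I ∩ (X ∩ Y).sym2).card := by
    exact_mod_cast card_inter_sym2_add_le I X Y
  have h2 := (hI.2 _ hXY).trans (refinedCount_le k s _)
  have h5 : ((X ∪ Y).card : ℤ) + (X ∩ Y).card = X.card + Y.card := by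
    exact_mod_cast Finset.card_union_add_card_inter X Y
  have h6 : k * ((X ∪ Y).card : ℤ) + k * (X ∩ Y).card = k * X.card + k * Y.card := by
    rw [← mul_add, h5, mul_add]
  have h7 := two_mul_card_inter_sym2_le (fun e he => hE e (hI.1 he)) (X ∩ Y)
  have hm : (1 : ℤ) ≤ (X ∩ Y).card := by exact_mod_cast hXY.card_pos
  have hmX : ((X ∩ Y).card : ℤ) < X.card := by
    exact_mod_cast Finset.card_lt_card ((Finset.inter_subset_left).ssubset_of_ne
      fun h => hsub (Finset.inter_eq_left.1 h))
  have hmY : ((X ∩ Y).card : ℤ) < Y.card := by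
    exact_mod_cast Finset.card_lt_card ((Finset.inter_subset_right).ssubset_of_ne
      fun h => hsub' (Finset.inter_eq_right.1 h))
  rw [hX.2, hY.2] at h1
  have hsmall : ((X ∩ Y).card : ℤ) ≤ 2 * k →
      ((I ∩ (X ∩ Y).sym2).card : ℤ) ≤ k * (X ∩ Y).card - 1 - s := fun h => by
    nlinarith [mul_nonneg (sub_nonneg.2 hm) (sub_nonneg.2 h)]
  unfold refinedCount at h1
  split_ifs at h1
  · linarith [hsmall (by lia)]
  · linarith [hsmall (by lia)]
  · linarith [hsmall (by lia)]
  · linarith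

theorem sum_card_inter_le (X : Finset V) {𝒯 : Finset (Finset V)}
    (h𝒯 : (𝒯 : Set (Finset V)).PairwiseDisjoint id) :
    ∑ T ∈ 𝒯, (X ∩ T).card ≤ X.card := by
  rw [← Finset.card_biUnion]
  · exact Finset.card_le_card (Finset.biUnion_subset.2 fun _ _ => Finset.inter_subset_left)
  · intro S hS T hT hne
    exact (h𝒯 hS hT hne).mono Finset.inter_subset_right Finset.inter_subset_right

/-- In a `(k + 1, -s)`-sparse edge set, the edges spanned by `T` exceed the refined count of `T` by
at most the size of some forest on those edges. -/
theorem exists_forest_card_le [Fintype V] {k s : ℤ} (hs : 1 ≤ s) (hsk : s ≤ k - 1)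
    {E : Finset (Sym2 V)} (hE : ∀ e ∈ E, ¬ e.IsDiag)
    (hsp : ∀ X : Finset V, 0 < (E ∩ X.sym2).card →
      ((E ∩ X.sym2).card : ℤ) ≤ (k + 1) * X.card - s)
    {A : Finset (Sym2 V)} (hA : A ⊆ E) {T : Finset V} (hT : T.Nonempty) :
    ∃ J ⊆ A ∩ T.sym2, CountIndep E forestCount J ∧
      ((A ∩ T.sym2).card : ℤ) ≤ refinedCount k s T + J.card := by
  obtain ⟨J, hJB, hJ, hmax⟩ := exists_maximal_countIndep (E := E) forestCount_nonneg (A ∩ T.sym2)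
  refine ⟨J, hJB, hJ, ?_⟩
  have hBE : A ∩ T.sym2 ⊆ E := Finset.inter_subset_left.trans hA
  obtain ⟨𝒮, hdisj, htight, hle⟩ := hJ.exists_tight_family (uncrosses_forestCount E) hBE hmax
  set B := A ∩ T.sym2 with hB
  set 𝒮' := 𝒮.filter fun S => 0 < (B ∩ S.sym2).card with h𝒮'
  have hsub : 𝒮' ⊆ 𝒮 := Finset.filter_subset _ _
  have hdisj' : (𝒮' : Set (Finset V)).PairwiseDisjoint id :=
    hdisj.subset (Finset.coe_subset.2 hsub)
  have hpos : ∀ S ∈ 𝒮', 0 < (B ∩ S.sym2).card := fun S hS => (Finset.mem_filter.1 hS).2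
  have hle' : (B.card : ℤ) - J.card ≤
      ∑ S ∈ 𝒮', (((B ∩ S.sym2).card : ℤ) - forestCount S) := by
    refine hle.trans ?_
    rw [← Finset.sum_sdiff hsub]
    refine add_le_of_nonpos_left (Finset.sum_nonpos fun S hS => ?_)
    obtain ⟨hS, hS'⟩ := Finset.mem_sdiff.1 hS
    have h0 : (B ∩ S.sym2).card = 0 := by
      by_contra h
      exact hS' (Finset.mem_filter.2 ⟨hS, Nat.pos_of_ne_zero h⟩)
    have := forestCount_nonneg S (htight S hS).1
    rw [h0]
    simpa using this
  have hST : ∀ S ∈ 𝒮', S ⊆ T := by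
    intro S hS
    obtain ⟨e, he⟩ := Finset.card_pos.1 (hpos S hS)
    have heST : e ∈ (S ∩ T).sym2 := by
      rw [Finset.sym2_inter]
      grind
    have hne : (S ∩ T).Nonempty := Finset.sym2_nonempty.1 ⟨e, heST⟩
    have hJS : J ∩ S.sym2 = J ∩ (S ∩ T).sym2 := by
      rw [Finset.sym2_inter]
      grind
    have h1 := (htight S (hsub hS)).2
    have h2 := hJ.2 _ hne
    rw [hJS] at h1
    unfold forestCount at h1 h2
    exact Finset.inter_eq_left.1
      (Finset.eq_of_subset_of_card_le Finset.inter_subset_left (by lia))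
  by_cases hcard : (T.card : ℤ) = 2 * k + 1
  · have href : refinedCount k s T = k * (2 * k + 1) - s := by
      unfold refinedCount
      rw [if_pos hcard, hcard]
      ring
    rw [href]
    by_cases hJs : s ≤ J.card
    · have := two_mul_card_inter_sym2_le (fun e he => hE e (hA he)) T
      rw [← hB, hcard] at this
      nlinarith
    · have h1 : ∑ S ∈ 𝒮', (2 * (((B ∩ S.sym2).card : ℤ) - forestCount S)) ≤
          ∑ S ∈ 𝒮', ((2 * k - 1) * ((J ∩ S.sym2).card : ℤ)) := by
        refine Finset.sum_le_sum fun S hS => ?_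
        have h2 := two_mul_card_inter_sym2_le (fun e he => hE e (hBE he)) S
        have h3 : (S.card : ℤ) ≤ T.card := by exact_mod_cast Finset.card_le_card (hST S hS)
        have h4 : (1 : ℤ) ≤ S.card := by exact_mod_cast (htight S (hsub hS)).1.card_pos
        rw [(htight S (hsub hS)).2]
        unfold forestCount
        nlinarith [mul_nonneg (sub_nonneg.2 h4) (sub_nonneg.2 h3)]
      rw [← Finset.mul_sum, ← Finset.mul_sum] at h1
      have h5 : ∑ S ∈ 𝒮', ((J ∩ S.sym2).card : ℤ) ≤ J.card := by
        exact_mod_cast sum_card_inter_sym2_le J hdisj'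
      have h6 := mul_le_mul_of_nonneg_left h5 (by lia : 0 ≤ 2 * k - 1)
      have h7 : (J.card : ℤ) ≤ s - 1 := by lia
      have h8 := mul_le_mul_of_nonneg_left h7 (by lia : 0 ≤ 2 * k + 1)
      nlinarith
  · have href : refinedCount k s T = k * T.card + 1 - s := by
      unfold refinedCount
      rw [if_neg hcard, sub_zero]
    rcases 𝒮'.eq_empty_or_nonempty with h | h
    · have := refinedCount_nonneg hs hsk T hT
      rw [h, Finset.sum_empty] at hle'
      lia
    · have h1 : ∑ S ∈ 𝒮', (((B ∩ S.sym2).card : ℤ) - forestCount S) ≤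
          ∑ S ∈ 𝒮', (k * ((T ∩ S).card : ℤ) - (s - 1)) := by
        refine Finset.sum_le_sum fun S hS => ?_
        have h2 : (B ∩ S.sym2).card ≤ (E ∩ S.sym2).card :=
          Finset.card_le_card (Finset.inter_subset_inter_right hBE)
        have h3 := hsp S ((hpos S hS).trans_le h2)
        rw [Finset.inter_eq_right.2 (hST S hS)]
        unfold forestCount
        lia
      replace h1 := hle'.trans h1
      rw [Finset.sum_sub_distrib, ← Finset.mul_sum, Finset.sum_const, nsmul_eq_mul] at h1
      have h5 : ∑ S ∈ 𝒮', ((T ∩ S).card : ℤ) ≤ T.card := by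
        exact_mod_cast sum_card_inter_le T hdisj'
      have h6 := mul_le_mul_of_nonneg_left h5 (by lia : 0 ≤ k)
      have h7 : (1 : ℤ) ≤ 𝒮'.card := by exact_mod_cast h.card_pos
      have h8 : s - 1 ≤ 𝒮'.card * (s - 1) := le_mul_of_one_le_left (by lia) h7
      lia

/-- A union of forests on pairwise disjoint vertex sets is a forest. -/
theorem CountIndep.biUnion_forest {E : Finset (Sym2 V)} {𝒯 : Finset (Finset V)}
    (h𝒯 : (𝒯 : Set (Finset V)).PairwiseDisjoint id) {J : Finset V → Finset (Sym2 V)}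
    (hJ : ∀ T ∈ 𝒯, CountIndep E forestCount (J T)) (hJT : ∀ T ∈ 𝒯, J T ⊆ T.sym2) :
    CountIndep E forestCount (𝒯.biUnion J) := by
  refine ⟨Finset.biUnion_subset.2 fun T hT => (hJ T hT).1, fun X hX => ?_⟩
  set 𝒬 := 𝒯.filter fun T => (X ∩ T).Nonempty with h𝒬
  have hsub : 𝒬 ⊆ 𝒯 := Finset.filter_subset _ _
  have hcover : 𝒯.biUnion J ∩ X.sym2 ⊆ 𝒬.biUnion fun T => J T ∩ (X ∩ T).sym2 := by
    intro e he
    obtain ⟨he, heX⟩ := Finset.mem_inter.1 he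
    obtain ⟨T, hT, heT⟩ := Finset.mem_biUnion.1 he
    have heXT : e ∈ (X ∩ T).sym2 := by
      rw [Finset.sym2_inter]
      exact Finset.mem_inter.2 ⟨heX, hJT T hT heT⟩
    exact Finset.mem_biUnion.2 ⟨T, Finset.mem_filter.2 ⟨hT, Finset.sym2_nonempty.1 ⟨e, heXT⟩⟩,
      Finset.mem_inter.2 ⟨heT, heXT⟩⟩
  have h1 : ((𝒯.biUnion J ∩ X.sym2).card : ℤ) ≤ ∑ T ∈ 𝒬, ((J T ∩ (X ∩ T).sym2).card : ℤ) := by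
    exact_mod_cast (Finset.card_le_card hcover).trans Finset.card_biUnion_le
  have h2 : ∑ T ∈ 𝒬, ((J T ∩ (X ∩ T).sym2).card : ℤ) ≤ ∑ T ∈ 𝒬, (((X ∩ T).card : ℤ) - 1) :=
    Finset.sum_le_sum fun T hT => (hJ T (hsub hT)).2 _ (Finset.mem_filter.1 hT).2
  rcases 𝒬.eq_empty_or_nonempty with h | h
  · rw [h, Finset.sum_empty] at h1
    exact h1.trans (forestCount_nonneg X hX)
  · have h3 : ∑ T ∈ 𝒬, ((X ∩ T).card : ℤ) ≤ X.card := by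
      exact_mod_cast sum_card_inter_le X (h𝒯.subset (Finset.coe_subset.2 hsub))
    have h4 : (1 : ℤ) ≤ 𝒬.card := by exact_mod_cast h.card_pos
    rw [Finset.sum_sub_distrib, Finset.sum_const, nsmul_eq_mul, mul_one] at h2
    unfold forestCount
    lia

/-- A `(k + 1, -s)`-sparse edge set is the disjoint union of a forest and a set satisfying the
refined count. -/
theorem exists_countIndep_partition [Fintype V] {k s : ℤ} (hs : 1 ≤ s) (hsk : s ≤ k - 1)
    {E : Finset (Sym2 V)} (hE : ∀ e ∈ E, ¬ e.IsDiag)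
    (hsp : ∀ X : Finset V, 0 < (E ∩ X.sym2).card →
      ((E ∩ X.sym2).card : ℤ) ≤ (k + 1) * X.card - s) :
    ∃ I₁ I₂ : Finset (Sym2 V), Disjoint I₁ I₂ ∧ I₁ ∪ I₂ = E ∧
      CountIndep E forestCount I₁ ∧ CountIndep E (refinedCount k s) I₂ := by
  classical
  have hU := uncrosses_refinedCount hsk hE
  have h0 := refinedCount_nonneg (V := V) hs hsk
  simp only [← countMatroid_indep forestCount_nonneg (uncrosses_forestCount E),
    ← countMatroid_indep h0 hU]
  refine Matroid.exists_indep_partition _ _ E fun A hA => ?_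
  simp only [countMatroid_indep]
  obtain ⟨I, hIA, hI, hmax⟩ := exists_maximal_countIndep (E := E) h0 A
  obtain ⟨𝒯, hdisj, htight, hle⟩ := hI.exists_tight_family hU hA hmax
  have hJ : ∀ T : Finset V, ∃ J : Finset (Sym2 V), T ∈ 𝒯 → J ⊆ A ∩ T.sym2 ∧
      CountIndep E forestCount J ∧ ((A ∩ T.sym2).card : ℤ) ≤ refinedCount k s T + J.card := by
    intro T
    by_cases hT : T ∈ 𝒯
    · obtain ⟨J, hJ⟩ := exists_forest_card_le hs hsk hE hsp hA (htight T hT).1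
      exact ⟨J, fun _ => hJ⟩
    · exact ⟨∅, fun h => absurd h hT⟩
  choose J hJ using hJ
  have hJT : ∀ T ∈ 𝒯, J T ⊆ T.sym2 := fun T hT => (hJ T hT).1.trans Finset.inter_subset_right
  refine ⟨𝒯.biUnion J,
    Finset.biUnion_subset.2 fun T hT => (hJ T hT).1.trans Finset.inter_subset_left, I, hIA,
    CountIndep.biUnion_forest hdisj (fun T hT => (hJ T hT).2.1) hJT, hI, ?_⟩
  rw [Finset.card_biUnion fun S hS T hT hne =>
    (Finset.disjoint_sym2 (hdisj hS hT hne)).mono (hJT S hS) (hJT T hT)]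
  have h1 : ∑ T ∈ 𝒯, (((A ∩ T.sym2).card : ℤ) - refinedCount k s T) ≤
      ∑ T ∈ 𝒯, ((J T).card : ℤ) :=
    Finset.sum_le_sum fun T hT => by linarith [(hJ T hT).2.2]
  zify
  linarith

end SparsePartition

/-- The edges of a subgraph are counted by the edges spanned by its vertex set. -/
theorem SimpleGraph.Subgraph.ncard_edgeSet_le {V : Type*} [DecidableEq V] [Fintype V]
    {I : Finset (Sym2 V)} (H : (SimpleGraph.fromEdgeSet (I : Set (Sym2 V))).Subgraph) :
    ∃ X : Finset V, X.card = H.verts.ncard ∧ (H.edgeSet.Nonempty → X.Nonempty) ∧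
      H.edgeSet.ncard ≤ (I ∩ X.sym2).card := by
  classical
  have hmem : ∀ e ∈ H.edgeSet, e ∈ I ∩ H.verts.toFinset.sym2 := by
    intro e he
    have heI := H.edgeSet_subset he
    rw [SimpleGraph.edgeSet_fromEdgeSet] at heI
    refine Finset.mem_inter.2 ⟨heI.1, Finset.mem_sym2_iff.2 fun v hv => ?_⟩
    exact Set.mem_toFinset.2 (H.mem_verts_of_mem_edge he hv)
  refine ⟨H.verts.toFinset, (Set.ncard_eq_toFinset_card' _).symm, fun ⟨e, he⟩ => ?_, ?_⟩
  · exact Finset.sym2_nonempty.1 ⟨e, (Finset.mem_inter.1 (hmem e he)).2⟩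
  · rw [← Set.ncard_coe_finset]
    exact Set.ncard_le_ncard hmem (Finset.finite_toSet _)

theorem IsSparse.card_inter_sym2_le {V : Type*} [DecidableEq V] [Fintype V] {G : SimpleGraph V}
    [Fintype G.edgeSet] {a b : ℝ} (hG : IsSparse G a b) (X : Finset V)
    (hX : 0 < (G.edgeFinset ∩ X.sym2).card) :
    ((G.edgeFinset ∩ X.sym2).card : ℝ) ≤ a * X.card + b := by
  have hset : ((⊤ : G.Subgraph).induce (X : Set V)).edgeSet =
      ((G.edgeFinset ∩ X.sym2 : Finset (Sym2 V)) : Set (Sym2 V)) := by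
    ext e
    induction e with
    | h u v =>
      simp only [SimpleGraph.Subgraph.mem_edgeSet, SimpleGraph.Subgraph.induce_adj,
        SimpleGraph.Subgraph.top_adj, Finset.mem_coe, Finset.mem_inter,
        SimpleGraph.mem_edgeFinset, SimpleGraph.mem_edgeSet, Finset.mk_mem_sym2_iff]
      tauto
  have := hG ((⊤ : G.Subgraph).induce (X : Set V))
    (by rw [hset]; exact Finset.card_pos.1 hX)
  rwa [hset, Set.ncard_coe_finset, SimpleGraph.Subgraph.induce_verts, Set.ncard_coe_finset] at this

theorem stmt12 (k s : ℤ) (hs1 : 1 ≤ s) (hsk : s ≤ k - 1)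
    {V : Type*} [Fintype V] (G : SimpleGraph V)
    (hG : IsSparse G ((k : ℝ) + 1) (-(s : ℝ))) :
    ∃ F G' : SimpleGraph V, F ≤ G ∧ G' ≤ G ∧
      F.edgeSet ∪ G'.edgeSet = G.edgeSet ∧ Disjoint F.edgeSet G'.edgeSet ∧
      IsSparse F 1 (-1) ∧ IsSparse G' (k : ℝ) (1 - (s : ℝ)) ∧
      ∀ H' : G'.Subgraph, (H'.verts.ncard : ℤ) = 2 * k + 1 →
        (H'.edgeSet.ncard : ℤ) ≤ (2 * k + 1) * k - s := by
  classical
  have hE : ∀ e ∈ G.edgeFinset, ¬ e.IsDiag := fun e he =>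
    G.not_isDiag_of_mem_edgeSet (SimpleGraph.mem_edgeFinset.1 he)
  obtain ⟨I₁, I₂, hd, hu, h₁, h₂⟩ := exists_countIndep_partition hs1 hsk hE fun X hX => by
    have := hG.card_inter_sym2_le X hX
    rw [← sub_eq_add_neg] at this
    exact_mod_cast this
  have hedge : ∀ I ⊆ G.edgeFinset,
      (SimpleGraph.fromEdgeSet (I : Set (Sym2 V))).edgeSet = (I : Set (Sym2 V)) := fun I hI => by
    rw [SimpleGraph.edgeSet_fromEdgeSet]
    exact sdiff_eq_left.2 (Set.disjoint_left.2 fun e he => hE e (hI he))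
  have hle : ∀ I ⊆ G.edgeFinset, SimpleGraph.fromEdgeSet (I : Set (Sym2 V)) ≤ G := fun I hI => by
    rw [← SimpleGraph.edgeSet_subset_edgeSet, hedge I hI, ← SimpleGraph.coe_edgeFinset]
    exact Finset.coe_subset.2 hI
  refine ⟨SimpleGraph.fromEdgeSet I₁, SimpleGraph.fromEdgeSet I₂, hle _ h₁.1, hle _ h₂.1, ?_, ?_,
    fun H hH => ?_, fun H hH => ?_, fun H hH => ?_⟩
  · rw [hedge _ h₁.1, hedge _ h₂.1, ← Finset.coe_union, hu, SimpleGraph.coe_edgeFinset]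
  · rw [hedge _ h₁.1, hedge _ h₂.1]
    exact Finset.disjoint_coe.2 hd
  · obtain ⟨X, hX, hne, hc⟩ := H.ncard_edgeSet_le
    have := h₁.2 X (hne hH)
    unfold forestCount at this
    have h : (H.edgeSet.ncard : ℤ) ≤ 1 * H.verts.ncard + (-1) := by lia
    exact_mod_cast h
  · obtain ⟨X, hX, hne, hc⟩ := H.ncard_edgeSet_le
    have := (h₂.2 X (hne hH)).trans (refinedCount_le k s X)
    rw [hX] at this
    have h : (H.edgeSet.ncard : ℤ) ≤ k * H.verts.ncard + (1 - s) := by lia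
    exact_mod_cast h
  · obtain ⟨X, hX, -, hc⟩ := H.ncard_edgeSet_le
    have hX' : (X.card : ℤ) = 2 * k + 1 := by rw [hX, hH]
    have := h₂.2 X (Finset.card_pos.1 (by lia))
    unfold refinedCount at this
    rw [if_pos hX', hX'] at this
    linarith [(by exact_mod_cast hc : (H.edgeSet.ncard : ℤ) ≤ (I₂ ∩ X.sym2).card)]
end

section
/- Let m ≥ 2 be a real number. If a finite simple graph G is (m,0)-sparse, then there exists an edge-partition E(G) = E(F) ∪ E(G′) such that F is (1,−1)-sparse (i.e., a forest) and G′ is (m, 1−2m)-sparse. -/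
section Cover

variable {α : Type*} [DecidableEq α]

/-- `Cover B X n`: the set `X` is a disjoint union of blocks of total cost `n`, where `B P c` says
that `P` is a block of cost `c`. -/
inductive Cover (B : Finset α → ℤ → Prop) : Finset α → ℤ → Prop
  | empty : Cover B ∅ 0
  | union {X P : Finset α} {n c : ℤ} :
      Cover B X n → B P c → Disjoint X P → Cover B (X ∪ P) (n + c)

/-- Intersecting blocks can be uncrossed without increasing the total cost. -/
def Uncrossing (B : Finset α → ℤ → Prop) : Prop :=
  ∀ ⦃P Q : Finset α⦄ ⦃a b : ℤ⦄, B P a → B Q b → (P ∩ Q).Nonempty →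
    ∃ a' c, B (P ∪ Q) a' ∧ Cover B (P ∩ Q) c ∧ a' + c ≤ a + b

variable {B : Finset α → ℤ → Prop}

lemma Cover.of_block {P : Finset α} {c : ℤ} (h : B P c) : Cover B P c := by
  simpa using Cover.union Cover.empty h (Finset.disjoint_empty_left P)

lemma Cover.disjoint_union {X Y : Finset α} {a b : ℤ} (hX : Cover B X a) (hY : Cover B Y b)
    (hd : Disjoint X Y) : Cover B (X ∪ Y) (a + b) := by
  induction hY with
  | empty => simpa using hX
  | @union Y P n c _ hP hYP ih =>
    rw [Finset.disjoint_union_right] at hd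
    have := Cover.union (ih hd.1) hP (Finset.disjoint_union_left.2 ⟨hd.2, hYP⟩)
    rwa [Finset.union_assoc, add_assoc] at this

lemma Cover.of_singletons (hs : ∀ e, B {e} 1) (X : Finset α) : Cover B X X.card := by
  induction X using Finset.induction_on with
  | empty => exact Cover.empty
  | insert e X he ih =>
    have := Cover.union ih (hs e) (by simpa using he)
    rw [Finset.card_insert_of_notMem he, Finset.insert_eq, Finset.union_comm]
    exact_mod_cast this

lemma Cover.uncross_block (hB : Uncrossing B) {X : Finset α} {n : ℤ} (hX : Cover B X n) :
    ∀ {Q : Finset α} {b : ℤ}, B Q b →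
      ∃ c d, Cover B (X ∪ Q) c ∧ Cover B (X ∩ Q) d ∧ c + d ≤ n + b := by
  induction hX with
  | empty =>
    intro Q b hQ
    exact ⟨b, 0, by simpa using Cover.of_block hQ, by simpa using Cover.empty, by simp⟩
  | @union X P n p _ hP hXP ih =>
    intro Q b hQ
    by_cases hPQ : (P ∩ Q).Nonempty
    · obtain ⟨a', c', hU, hI, hle⟩ := hB hP hQ hPQ
      obtain ⟨c, d, hc, hd, hcd⟩ := ih hU
      refine ⟨c, d + c', by rwa [Finset.union_assoc], ?_, by linarith⟩
      have h1 : X ∩ (P ∪ Q) = X ∩ Q := by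
        rw [Finset.inter_union_distrib_left, Finset.disjoint_iff_inter_eq_empty.1 hXP,
          Finset.empty_union]
      rw [h1] at hd
      rw [Finset.union_inter_distrib_right]
      exact hd.disjoint_union hI (hXP.mono Finset.inter_subset_left Finset.inter_subset_left)
    · rw [Finset.not_nonempty_iff_eq_empty] at hPQ
      obtain ⟨c, d, hc, hd, hcd⟩ := ih hQ
      refine ⟨c + p, d, ?_, ?_, by linarith⟩
      · rw [Finset.union_right_comm]
        refine Cover.union hc hP (Finset.disjoint_union_left.2 ⟨hXP, ?_⟩)
        rw [Finset.disjoint_iff_inter_eq_empty, Finset.inter_comm, hPQ]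
      · rwa [Finset.union_inter_distrib_right, hPQ, Finset.union_empty]

lemma Cover.submodular (hB : Uncrossing B) {X Y : Finset α} {a b : ℤ} (hX : Cover B X a)
    (hY : Cover B Y b) : ∃ c d, Cover B (X ∪ Y) c ∧ Cover B (X ∩ Y) d ∧ c + d ≤ a + b := by
  induction hY with
  | empty => exact ⟨a, 0, by simpa using hX, by simpa using Cover.empty, by simp⟩
  | @union Y Q n q _ hQ hYQ ih =>
    obtain ⟨c, d, hc, hd, hcd⟩ := ih
    obtain ⟨c', d', hc', hd', hcd'⟩ := hc.uncross_block hB hQ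
    refine ⟨c', d + d', by rwa [← Finset.union_assoc], ?_, by linarith⟩
    rw [Finset.union_inter_distrib_right, Finset.disjoint_iff_inter_eq_empty.1 hYQ,
      Finset.union_empty] at hd'
    rw [Finset.inter_union_distrib_left]
    exact hd.disjoint_union hd' (hYQ.mono Finset.inter_subset_right Finset.inter_subset_right)

/-- A partition theorem in the style of matroid union: if every `X` has at most as many elements
as the sum of the costs of any two of its covers, then the ground set splits into two parts whose
covers cost at least their size. -/
lemma exists_partition_of_card_le_cover {B₁ B₂ : Finset α → ℤ → Prop} (h₁ : Uncrossing B₁)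
    (h₂ : Uncrossing B₂) (E : Finset α)
    (hE : ∀ X ⊆ E, ∀ a b, Cover B₁ X a → Cover B₂ X b → (X.card : ℤ) ≤ a + b) :
    ∃ I₁ I₂ : Finset α, I₁ ∪ I₂ = E ∧ Disjoint I₁ I₂ ∧
      ∀ a b, Cover B₁ I₁ a → Cover B₂ I₂ b → (I₁.card : ℤ) + I₂.card ≤ a + b := by
  suffices H : ∀ R I₁ I₂ : Finset α, Disjoint I₁ I₂ → Disjoint R (I₁ ∪ I₂) →
      (∀ X ⊆ R, ∀ a b, Cover B₁ (X ∪ I₁) a → Cover B₂ (X ∪ I₂) b →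
        (X.card : ℤ) + I₁.card + I₂.card ≤ a + b) →
      ∃ J₁ J₂ : Finset α, J₁ ∪ J₂ = R ∪ (I₁ ∪ I₂) ∧ Disjoint J₁ J₂ ∧
        ∀ a b, Cover B₁ J₁ a → Cover B₂ J₂ b → (J₁.card : ℤ) + J₂.card ≤ a + b by
    simpa using H E ∅ ∅ (by simp) (by simp) (by simpa using hE)
  intro R
  induction R using Finset.induction_on with
  | empty =>
    intro I₁ I₂ hd _ h
    exact ⟨I₁, I₂, by simp, hd, by simpa using h ∅ le_rfl⟩
  | insert e R he ih =>
    intro I₁ I₂ hd hR h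
    have he₁ : e ∉ I₁ := fun h' => by
      simpa [h'] using Finset.disjoint_left.1 hR (Finset.mem_insert_self e R)
    have he₂ : e ∉ I₂ := fun h' => by
      simpa [h'] using Finset.disjoint_left.1 hR (Finset.mem_insert_self e R)
    have hR' : Disjoint R (I₁ ∪ I₂) := hR.mono_left (Finset.subset_insert e R)
    by_cases hc₁ : ∀ X ⊆ R, ∀ a b, Cover B₁ (X ∪ insert e I₁) a → Cover B₂ (X ∪ I₂) b →
        (X.card : ℤ) + (insert e I₁).card + I₂.card ≤ a + b
    · obtain ⟨J₁, J₂, hu, h'⟩ := ih (insert e I₁) I₂ (by simp [he₂, hd])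
        (by rw [Finset.insert_union]; simp [he, hR']) hc₁
      exact ⟨J₁, J₂, by rw [hu]; ext; simp, h'⟩
    by_cases hc₂ : ∀ X ⊆ R, ∀ a b, Cover B₁ (X ∪ I₁) a → Cover B₂ (X ∪ insert e I₂) b →
        (X.card : ℤ) + I₁.card + (insert e I₂).card ≤ a + b
    · obtain ⟨J₁, J₂, hu, h'⟩ := ih I₁ (insert e I₂) (by simp [he₁, hd])
        (by rw [Finset.union_insert]; simp [he, hR']) hc₂
      exact ⟨J₁, J₂, by rw [hu]; ext; simp, h'⟩
    exfalso
    push Not at hc₁ hc₂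
    obtain ⟨X, hX, a, b, ha, hb, hlt⟩ := hc₁
    obtain ⟨Y, hY, a', b', ha', hb', hlt'⟩ := hc₂
    obtain ⟨p, q, hp, hq, hpq⟩ := ha.submodular h₁ ha'
    obtain ⟨r, s, hr, hs, hrs⟩ := hb.submodular h₂ hb'
    have heX : e ∉ X := fun h' => he (hX h')
    have heY : e ∉ Y := fun h' => he (hY h')
    have e₁ : X ∪ insert e I₁ ∪ (Y ∪ I₁) = insert e (X ∪ Y) ∪ I₁ := by ext; simp; tauto
    have e₂ : X ∪ I₂ ∪ (Y ∪ insert e I₂) = insert e (X ∪ Y) ∪ I₂ := by ext; simp; tauto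
    have e₃ : (X ∪ insert e I₁) ∩ (Y ∪ I₁) = X ∩ Y ∪ I₁ := by
      ext x; by_cases hx : x = e <;> simp [hx, heX, heY, he₁]; tauto
    have e₄ : (X ∪ I₂) ∩ (Y ∪ insert e I₂) = X ∩ Y ∪ I₂ := by
      ext x; by_cases hx : x = e <;> simp [hx, heX, heY, he₂]; tauto
    rw [e₁] at hp; rw [e₂] at hr; rw [e₃] at hq; rw [e₄] at hs
    have hU := h _ (Finset.insert_subset_insert e (Finset.union_subset hX hY)) _ _ hp hr
    have hI := h (X ∩ Y) ((Finset.inter_subset_left.trans hX).trans (Finset.subset_insert e R))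
      _ _ hq hs
    have hcard := Finset.card_union_add_card_inter X Y
    rw [Finset.card_insert_of_notMem (by simp [heX, heY])] at hU
    rw [Finset.card_insert_of_notMem he₁] at hlt
    rw [Finset.card_insert_of_notMem he₂] at hlt'
    push_cast at *
    omega

end Cover

section Incidence

variable {α V : Type*} [DecidableEq V] {ends : α → Finset V}

/-- The set of vertices covered by a set of edges. -/
def edgeSupport (ends : α → Finset V) (X : Finset α) : Finset V := X.biUnion ends

lemma edgeSupport_mono {X Y : Finset α} (h : X ⊆ Y) :
    edgeSupport ends X ⊆ edgeSupport ends Y :=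
  Finset.biUnion_subset_biUnion_of_subset_left ends h

lemma card_edgeSupport_mono {X Y : Finset α} (h : X ⊆ Y) :
    (edgeSupport ends X).card ≤ (edgeSupport ends Y).card :=
  Finset.card_le_card (edgeSupport_mono h)

lemma edgeSupport_union [DecidableEq α] (X Y : Finset α) :
    edgeSupport ends (X ∪ Y) = edgeSupport ends X ∪ edgeSupport ends Y :=
  Finset.union_biUnion

lemma edgeSupport_inter_subset [DecidableEq α] (X Y : Finset α) :
    edgeSupport ends (X ∩ Y) ⊆ edgeSupport ends X ∩ edgeSupport ends Y :=
  Finset.subset_inter (edgeSupport_mono Finset.inter_subset_left)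
    (edgeSupport_mono Finset.inter_subset_right)

lemma two_le_card_edgeSupport (h₂ : ∀ e, (ends e).card = 2) {X : Finset α} (hX : X.Nonempty) :
    2 ≤ (edgeSupport ends X).card := by
  obtain ⟨e, he⟩ := hX
  rw [← h₂ e]
  exact Finset.card_le_card (Finset.subset_biUnion_of_mem ends he)

lemma two_mul_card_le (h₂ : ∀ e, (ends e).card = 2) (hinj : Function.Injective ends)
    (X : Finset α) :
    2 * (X.card : ℤ) ≤ (edgeSupport ends X).card * ((edgeSupport ends X).card - 1) := by
  have h : X.card ≤ (edgeSupport ends X).card.choose 2 := by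
    rw [← Finset.card_powersetCard, ← Finset.card_map ⟨ends, hinj⟩]
    refine Finset.card_le_card fun s hs => ?_
    obtain ⟨e, he, rfl⟩ := Finset.mem_map.1 hs
    exact Finset.mem_powersetCard.2 ⟨Finset.subset_biUnion_of_mem ends he, h₂ e⟩
  rw [Nat.choose_two_right, Nat.le_div_iff_mul_le two_pos] at h
  obtain h0 | h0 := Nat.eq_zero_or_pos (edgeSupport ends X).card
  · have hX : X = ∅ := by simpa [h0] using h
    simp [edgeSupport, hX]
  · zify [h0] at h
    linarith

lemma disjoint_of_disjoint_edgeSupport (h₂ : ∀ e, (ends e).card = 2) {X Y : Finset α}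
    (h : Disjoint (edgeSupport ends X) (edgeSupport ends Y)) : Disjoint X Y := by
  refine Finset.disjoint_left.2 fun e hX hY => ?_
  obtain ⟨v, hv⟩ := Finset.card_pos.1 (h₂ e ▸ two_pos : 0 < (ends e).card)
  exact Finset.disjoint_left.1 h (Finset.mem_biUnion.2 ⟨e, hX, hv⟩)
    (Finset.mem_biUnion.2 ⟨e, hY, hv⟩)

/-- Nonempty edge sets as blocks, the cost being the size of a spanning tree of the support. -/
def ForestBlock (ends : α → Finset V) (P : Finset α) (c : ℤ) : Prop :=
  P.Nonempty ∧ c = (edgeSupport ends P).card - 1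

lemma ForestBlock.singleton (h₂ : ∀ e, (ends e).card = 2) (e : α) :
    ForestBlock ends {e} 1 :=
  ⟨Finset.singleton_nonempty e, by simp [edgeSupport, h₂]⟩

/-- The linear function `k * x + d`, lowered by `δ` at `x = N`. -/
def blockCost (N k : ℕ) (d δ : ℤ) (x : ℕ) : ℤ := k * x + d - if x = N then δ else 0

/-- Single edges, of cost `1`, and edge sets covering at least `N` vertices, whose cost is given
by `blockCost`. -/
def SparseBlock (ends : α → Finset V) (N k : ℕ) (d δ : ℤ) (P : Finset α) (c : ℤ) : Prop :=
  (∃ e, P = {e} ∧ c = 1) ∨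
    (N ≤ (edgeSupport ends P).card ∧ c = blockCost N k d δ (edgeSupport ends P).card)

lemma SparseBlock.singleton (N k : ℕ) (d δ : ℤ) (e : α) : SparseBlock ends N k d δ {e} 1 :=
  Or.inl ⟨e, rfl, rfl⟩

variable [DecidableEq α]

lemma ForestBlock.uncrossing : Uncrossing (ForestBlock ends) := by
  rintro P Q a b ⟨hP, rfl⟩ ⟨hQ, rfl⟩ hPQ
  refine ⟨_, _, ⟨hP.mono Finset.subset_union_left, rfl⟩, Cover.of_block ⟨hPQ, rfl⟩, ?_⟩
  have h := Finset.card_union_add_card_inter (edgeSupport ends P) (edgeSupport ends Q)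
  have h' := Finset.card_le_card (edgeSupport_inter_subset (ends := ends) P Q)
  rw [edgeSupport_union]
  omega

/-- `VertexDisjointCover ends X n`: the set `X` is a union of forest blocks with pairwise disjoint
supports of total cost `n`. -/
inductive VertexDisjointCover (ends : α → Finset V) : Finset α → ℤ → Prop
  | empty : VertexDisjointCover ends ∅ 0
  | union {X P : Finset α} {n : ℤ} : VertexDisjointCover ends X n → P.Nonempty →
      Disjoint (edgeSupport ends X) (edgeSupport ends P) →
      VertexDisjointCover ends (X ∪ P) (n + ((edgeSupport ends P).card - 1))

lemma VertexDisjointCover.add_block {X : Finset α} {n : ℤ} (hX : VertexDisjointCover ends X n) :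
    ∀ {P : Finset α}, P.Nonempty → ∃ n' ≤ n + ((edgeSupport ends P).card - 1),
      VertexDisjointCover ends (X ∪ P) n' := by
  induction hX with
  | empty =>
    intro P hP
    exact ⟨_, le_rfl, VertexDisjointCover.empty.union hP (by simp [edgeSupport])⟩
  | @union X Q n _ hQ hd ih =>
    intro P hP
    by_cases hPQ : Disjoint (edgeSupport ends P) (edgeSupport ends Q)
    · obtain ⟨n', hn', h⟩ := ih hP
      refine ⟨n' + ((edgeSupport ends Q).card - 1), by linarith, ?_⟩
      rw [Finset.union_right_comm]
      refine h.union hQ ?_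
      rw [edgeSupport_union]
      exact Finset.disjoint_union_left.2 ⟨hd, hPQ⟩
    · obtain ⟨n', hn', h⟩ := ih (hQ.mono (Finset.subset_union_left (s₂ := P)))
      refine ⟨n', ?_, by rwa [Finset.union_assoc]⟩
      have h₁ := Finset.card_union_add_card_inter (edgeSupport ends Q) (edgeSupport ends P)
      have h₂ : 0 < (edgeSupport ends Q ∩ edgeSupport ends P).card := by
        rw [Finset.card_pos, ← Finset.not_disjoint_iff_nonempty_inter]
        exact fun h => hPQ h.symm
      rw [edgeSupport_union] at hn'
      omega

lemma Cover.exists_vertexDisjointCover {X : Finset α} {a : ℤ} (h : Cover (ForestBlock ends) X a) :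
    ∃ n ≤ a, VertexDisjointCover ends X n := by
  induction h with
  | empty => exact ⟨0, le_rfl, VertexDisjointCover.empty⟩
  | union _ hP _ ih =>
    obtain ⟨n, hn, h⟩ := ih
    obtain ⟨hP, rfl⟩ := hP
    obtain ⟨n', hn', h'⟩ := h.add_block hP
    exact ⟨n', by linarith, h'⟩

/-- The numerical conditions on the parameters of `SparseBlock` under which covers by forest blocks
and sparse blocks of an `(m, 0)`-sparse graph are always expensive enough. -/
structure Admissible (m : ℝ) (N k : ℕ) (d δ : ℤ) : Prop where
  two_le : 2 ≤ k
  three_le : 3 ≤ N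
  le_two_mul : (N : ℝ) ≤ 2 * m
  nonpos : d ≤ 0
  nonneg : 0 ≤ δ
  le_one : δ ≤ 1
  small : ∀ i : ℕ, 2 ≤ i → i < N → (i : ℤ) * (i - 1) ≤ 2 * (k * i + d - 2 * δ)
  le_sub_one_add : ∀ x q : ℕ, N ≤ x → 2 * (q : ℤ) ≤ x * (x - 1) → (q : ℝ) ≤ m * x →
    (q : ℤ) ≤ x - 1 + blockCost N k d δ x
  cost_le : ∀ x : ℕ, N ≤ x → (blockCost N k d δ x : ℝ) ≤ m * (x - 2) + 1
  le_cost : ∀ x : ℕ, N ≤ x → (m - 1) * (x - 1) + 1 / 2 ≤ (blockCost N k d δ x : ℝ)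

variable {m : ℝ} {N k : ℕ} {d δ : ℤ}

lemma Admissible.exists_cover (h : Admissible m N k d δ) (h₂ : ∀ e, (ends e).card = 2)
    (hinj : Function.Injective ends) {X : Finset α} (hX : X.Nonempty) :
    ∃ c, Cover (SparseBlock ends N k d δ) X c ∧
      c ≤ blockCost N k d δ (edgeSupport ends X).card ∧
      ((edgeSupport ends X).card < N → c ≤ k * (edgeSupport ends X).card + d - 2 * δ) := by
  by_cases hN : N ≤ (edgeSupport ends X).card
  · exact ⟨_, Cover.of_block (Or.inr ⟨hN, rfl⟩), le_rfl, fun h' => by omega⟩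
  · have h₁ := h.small _ (two_le_card_edgeSupport h₂ hX) (by omega)
    have h₃ := two_mul_card_le h₂ hinj X
    have h₄ : (X.card : ℤ) ≤ k * (edgeSupport ends X).card + d - 2 * δ := by linarith
    refine ⟨_, Cover.of_singletons (SparseBlock.singleton N k d δ) X, ?_, fun _ => h₄⟩
    have := h.nonneg
    rw [blockCost, if_neg (by omega)]
    linarith

lemma Admissible.uncrossing (h : Admissible m N k d δ) (h₂ : ∀ e, (ends e).card = 2)
    (hinj : Function.Injective ends) : Uncrossing (SparseBlock ends N k d δ) := by
  intro P Q a b hP hQ hPQ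
  obtain ⟨e, rfl, rfl⟩ | ⟨hNP, rfl⟩ := id hP
  · have he : e ∈ Q := by
      obtain ⟨f, hf⟩ := hPQ
      simp only [Finset.mem_inter, Finset.mem_singleton] at hf
      exact hf.1 ▸ hf.2
    rw [Finset.union_eq_right.2 (Finset.singleton_subset_iff.2 he),
      Finset.inter_eq_left.2 (Finset.singleton_subset_iff.2 he)]
    exact ⟨b, 1, hQ, Cover.of_block hP, by linarith⟩
  obtain ⟨e, rfl, rfl⟩ | ⟨hNQ, rfl⟩ := id hQ
  · have he : e ∈ P := by
      obtain ⟨f, hf⟩ := hPQ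
      simp only [Finset.mem_inter, Finset.mem_singleton] at hf
      exact hf.2 ▸ hf.1
    rw [Finset.union_eq_left.2 (Finset.singleton_subset_iff.2 he),
      Finset.inter_eq_right.2 (Finset.singleton_subset_iff.2 he)]
    exact ⟨_, 1, hP, Cover.of_block hQ, le_rfl⟩
  obtain ⟨c, hc, hc₁, hc₂⟩ := h.exists_cover h₂ hinj hPQ
  have hu := card_edgeSupport_mono (ends := ends) (Finset.subset_union_left (s₁ := P) (s₂ := Q))
  have hu' := card_edgeSupport_mono (ends := ends) (Finset.subset_union_right (s₁ := P) (s₂ := Q))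
  refine ⟨_, c, Or.inr ⟨hNP.trans hu, rfl⟩, hc, ?_⟩
  have h₃ := Finset.card_union_add_card_inter (edgeSupport ends P) (edgeSupport ends Q)
  have h₄ := Finset.card_le_card (edgeSupport_inter_subset (ends := ends) P Q)
  have h₅ := card_edgeSupport_mono (ends := ends) (Finset.inter_subset_left (s₁ := P) (s₂ := Q))
  have h₆ := card_edgeSupport_mono (ends := ends) (Finset.inter_subset_right (s₁ := P) (s₂ := Q))
  rw [← edgeSupport_union] at h₃
  have hk := h.two_le
  have hδ := h.nonneg
  have hδ' := h.le_one
  generalize (edgeSupport ends (P ∪ Q)).card = u at *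
  generalize (edgeSupport ends (P ∩ Q)).card = i' at *
  generalize (edgeSupport ends P ∩ edgeSupport ends Q).card = i at *
  generalize (edgeSupport ends P).card = p at *
  generalize (edgeSupport ends Q).card = q at *
  obtain ⟨t, rfl⟩ := Nat.exists_eq_add_of_le h₄
  have e₁ : (k : ℤ) * u + k * i' + k * t = k * p + k * q := by
    have : (u : ℤ) + (i' + t) = p + q := by exact_mod_cast h₃
    linear_combination (k : ℤ) * this
  have e₂ : t = 0 ∨ 2 ≤ (k : ℤ) * t := by
    obtain ht | ht := Nat.eq_zero_or_pos t
    · exact Or.inl ht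
    · right
      have : 2 * 1 ≤ k * t := Nat.mul_le_mul hk ht
      exact_mod_cast this
  have e₃ : 0 ≤ (k : ℤ) * t := by positivity
  generalize (k : ℤ) * t = kt at *
  unfold blockCost at *
  generalize (k : ℤ) * u = ku at *
  generalize (k : ℤ) * i' = ki at *
  generalize (k : ℤ) * p = kp at *
  generalize (k : ℤ) * q = kq at *
  split_ifs at * <;> omega

lemma Admissible.split_block (h : Admissible m N k d δ) (h₂ : ∀ e, (ends e).card = 2)
    (hinj : Function.Injective ends) {X P Q : Finset α} {c : ℤ}
    (hd : Disjoint (edgeSupport ends X) (edgeSupport ends P)) (hQ : SparseBlock ends N k d δ Q c)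
    (hsub : Q ⊆ X ∪ P) :
    ∃ c₁ c₂, Cover (SparseBlock ends N k d δ) (Q ∩ X) c₁ ∧
      Cover (SparseBlock ends N k d δ) (Q ∩ P) c₂ ∧ c₁ + c₂ ≤ c := by
  have hXP := disjoint_of_disjoint_edgeSupport h₂ hd
  have hQu : Q ∩ X ∪ Q ∩ P = Q := by
    rw [← Finset.inter_union_distrib_left, Finset.inter_eq_left.2 hsub]
  obtain hX | hX := (Q ∩ X).eq_empty_or_nonempty
  · rw [hX, Finset.empty_union] at hQu
    rw [hX, hQu]
    exact ⟨0, c, Cover.empty, Cover.of_block hQ, by simp⟩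
  obtain hP | hP := (Q ∩ P).eq_empty_or_nonempty
  · rw [hP, Finset.union_empty] at hQu
    rw [hP, hQu]
    exact ⟨c, 0, Cover.of_block hQ, Cover.empty, by simp⟩
  obtain ⟨e, rfl, rfl⟩ | ⟨hN, rfl⟩ := hQ
  · obtain ⟨f, hf⟩ := hX
    obtain ⟨g, hg⟩ := hP
    simp only [Finset.mem_inter, Finset.mem_singleton] at hf hg
    exact absurd (hg.1 ▸ hg.2) (Finset.disjoint_left.1 hXP (hf.1 ▸ hf.2))
  obtain ⟨c₁, hc₁, hle₁, hs₁⟩ := h.exists_cover h₂ hinj hX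
  obtain ⟨c₂, hc₂, hle₂, hs₂⟩ := h.exists_cover h₂ hinj hP
  refine ⟨c₁, c₂, hc₁, hc₂, ?_⟩
  have hcard : (edgeSupport ends Q).card =
      (edgeSupport ends (Q ∩ X)).card + (edgeSupport ends (Q ∩ P)).card := by
    rw [← Finset.card_union_of_disjoint (hd.mono (edgeSupport_mono Finset.inter_subset_right)
      (edgeSupport_mono Finset.inter_subset_right)), ← edgeSupport_union, hQu]
  have hX2 := two_le_card_edgeSupport h₂ hX
  have hP2 := two_le_card_edgeSupport h₂ hP
  have hδ := h.nonneg
  have hd0 := h.nonpos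
  rw [hcard] at hN ⊢
  generalize (edgeSupport ends (Q ∩ X)).card = x at *
  generalize (edgeSupport ends (Q ∩ P)).card = p at *
  unfold blockCost at *
  push_cast
  rw [mul_add]
  generalize (k : ℤ) * x = kx at *
  generalize (k : ℤ) * p = kp at *
  split_ifs at * <;> omega

lemma Admissible.split_cover (h : Admissible m N k d δ) (h₂ : ∀ e, (ends e).card = 2)
    (hinj : Function.Injective ends) {X P Z : Finset α} {b : ℤ}
    (hd : Disjoint (edgeSupport ends X) (edgeSupport ends P))
    (hZ : Cover (SparseBlock ends N k d δ) Z b) (hsub : Z ⊆ X ∪ P) :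
    ∃ b₁ b₂, Cover (SparseBlock ends N k d δ) (Z ∩ X) b₁ ∧
      Cover (SparseBlock ends N k d δ) (Z ∩ P) b₂ ∧ b₁ + b₂ ≤ b := by
  induction hZ with
  | empty => exact ⟨0, 0, by simpa using Cover.empty, by simpa using Cover.empty, by simp⟩
  | union _ hQ hZQ ih =>
    obtain ⟨b₁, b₂, hb₁, hb₂, hb⟩ := ih (Finset.subset_union_left.trans hsub)
    obtain ⟨c₁, c₂, hc₁, hc₂, hc⟩ :=
      h.split_block h₂ hinj hd hQ (Finset.subset_union_right.trans hsub)
    refine ⟨b₁ + c₁, b₂ + c₂, ?_, ?_, by linarith⟩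
    · rw [Finset.union_inter_distrib_right]
      exact hb₁.disjoint_union hc₁ (hZQ.mono Finset.inter_subset_left Finset.inter_subset_left)
    · rw [Finset.union_inter_distrib_right]
      exact hb₂.disjoint_union hc₂ (hZQ.mono Finset.inter_subset_left Finset.inter_subset_left)

/-- Estimates for a cover by `q` large blocks with union `Y` and by single edges, where `s` is the
total cost of the large blocks as forest blocks. -/
lemma Admissible.cover_estimates (h : Admissible m N k d δ) (h₂ : ∀ e, (ends e).card = 2)
    (hinj : Function.Injective ends) (hm : ∀ X, (X.card : ℝ) ≤ m * (edgeSupport ends X).card)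
    {X : Finset α} {b : ℤ} (hX : Cover (SparseBlock ends N k d δ) X b) :
    ∃ Y ⊆ X, ∃ s q : ℕ, (X.card : ℤ) ≤ b + s ∧
      (X.card : ℝ) - Y.card + (m - 1) * s + q / 2 ≤ b ∧
      (q = 0 → s = 0) ∧ (q = 1 → s + 1 ≤ (edgeSupport ends X).card) := by
  induction hX with
  | empty => exact ⟨∅, le_rfl, 0, 0, by simp⟩
  | @union X P n c _ hP hd ih =>
    obtain ⟨Y, hY, s, q, h₃, h₄, h₅, h₆⟩ := ih
    have hcard := Finset.card_union_of_disjoint hd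
    have hmX := card_edgeSupport_mono (ends := ends) (Finset.subset_union_left (s₁ := X) (s₂ := P))
    have hmP := card_edgeSupport_mono (ends := ends) (Finset.subset_union_right (s₁ := X) (s₂ := P))
    obtain ⟨e, rfl, rfl⟩ | ⟨hN, rfl⟩ := hP
    · rw [Finset.card_singleton] at hcard
      refine ⟨Y, hY.trans Finset.subset_union_left, s, q, ?_, ?_, h₅, fun hq => (h₆ hq).trans hmX⟩
      · rw [hcard]; push_cast; linarith
      · rw [hcard]; push_cast; linarith
    · have h₇ := h.le_sub_one_add _ _ hN (two_mul_card_le h₂ hinj P) (hm P)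
      have h₈ := h.le_cost _ hN
      have h₉ := h.three_le
      have hYc := Finset.card_union_of_disjoint (hd.mono_left hY)
      obtain ⟨v, hv⟩ : ∃ v, (edgeSupport ends P).card = v + 1 :=
        Nat.exists_eq_add_of_le' (by omega)
      rw [hv] at h₇ h₈ hmP
      rw [hv]
      push_cast at h₇ h₈
      refine ⟨Y ∪ P, Finset.union_subset_union hY le_rfl, s + v, q + 1, ?_, ?_, by simp, ?_⟩
      · rw [hcard]; push_cast; linarith
      · rw [hcard, hYc]; push_cast; linarith
      · intro hq
        rw [h₅ (by omega)]
        omega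

lemma Admissible.card_le_of_cover (h : Admissible m N k d δ) (h₂ : ∀ e, (ends e).card = 2)
    (hinj : Function.Injective ends) (hm : ∀ X, (X.card : ℝ) ≤ m * (edgeSupport ends X).card)
    {X : Finset α} {b : ℤ} (hne : X.Nonempty) (hX : Cover (SparseBlock ends N k d δ) X b) :
    (X.card : ℤ) ≤ (edgeSupport ends X).card - 1 + b := by
  obtain ⟨Y, hY, s, q, h₃, h₄, h₅, h₆⟩ := h.cover_estimates h₂ hinj hm hX
  have hx := two_le_card_edgeSupport h₂ hne
  by_cases hs : s + 1 ≤ (edgeSupport ends X).card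
  · omega
  have hq : 2 ≤ q := by
    by_contra hq
    obtain rfl | rfl : q = 0 ∨ q = 1 := by omega
    · simp only [h₅] at hs; omega
    · exact hs (h₆ rfl)
  have hm2 : 3 ≤ 2 * m := le_trans (by exact_mod_cast h.three_le) h.le_two_mul
  have hYX : (Y.card : ℝ) ≤ m * (edgeSupport ends X).card :=
    (hm Y).trans (mul_le_mul_of_nonneg_left (by exact_mod_cast card_edgeSupport_mono hY)
      (by linarith))
  have hs' : ((edgeSupport ends X).card : ℝ) ≤ s := by exact_mod_cast (by omega)
  have hq' : (2 : ℝ) ≤ q := by exact_mod_cast hq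
  have hms := mul_le_mul_of_nonneg_left hs' (by linarith : 0 ≤ m - 1)
  have : (X.card : ℝ) ≤ (edgeSupport ends X).card - 1 + b := by linarith
  exact_mod_cast this

lemma Admissible.card_le_of_covers (h : Admissible m N k d δ) (h₂ : ∀ e, (ends e).card = 2)
    (hinj : Function.Injective ends) (hm : ∀ X, (X.card : ℝ) ≤ m * (edgeSupport ends X).card)
    {X : Finset α} {n : ℤ} (hX : VertexDisjointCover ends X n) :
    ∀ b : ℤ, Cover (SparseBlock ends N k d δ) X b → (X.card : ℤ) ≤ n + b := by
  induction hX with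
  | empty =>
    intro b hb
    obtain ⟨Y, hY, s, q, -, h₄, -, -⟩ := h.cover_estimates h₂ hinj hm hb
    have hm2 : 3 ≤ 2 * m := le_trans (by exact_mod_cast h.three_le) h.le_two_mul
    have hms : 0 ≤ (m - 1) * s := mul_nonneg (by linarith) (by positivity)
    have hq : (0 : ℝ) ≤ q / 2 := by positivity
    rw [Finset.subset_empty.1 hY, sub_self, zero_add] at h₄
    have : (0 : ℝ) ≤ b := by linarith
    simpa using this
  | @union X P n _ hP hd ih =>
    intro b hb
    obtain ⟨b₁, b₂, hb₁, hb₂, hle⟩ := h.split_cover h₂ hinj hd hb le_rfl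
    rw [Finset.union_inter_cancel_left] at hb₁
    rw [Finset.union_inter_cancel_right] at hb₂
    have h₃ := ih _ hb₁
    have h₄ := h.card_le_of_cover h₂ hinj hm hP hb₂
    rw [Finset.card_union_of_disjoint (disjoint_of_disjoint_edgeSupport h₂ hd)]
    push_cast
    linarith

end Incidence

section Parameters

lemma admissible_of_lt_half {k : ℕ} {ε : ℝ} {j : ℤ} (hk : 2 ≤ k) (h0 : 0 ≤ ε) (h1 : ε < 1 / 2)
    (hj : j ≤ ε * (2 * k - 2)) (hj' : ε * (2 * k - 2) < j + 1) :
    Admissible (k + ε) (2 * k) k (1 - 2 * k + j) 0 := by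
  have hkR : (2 : ℝ) ≤ k := by exact_mod_cast hk
  have hj0 : 0 ≤ j := by
    have : (-1 : ℝ) < j := by nlinarith
    have : (-1 : ℤ) < j := by exact_mod_cast this
    omega
  have hjk : j ≤ k - 1 := by
    have : (j : ℝ) ≤ k - 1 := by nlinarith
    exact_mod_cast this
  refine ⟨hk, by omega, by push_cast; linarith, by omega, le_rfl, zero_le_one, ?_, ?_, ?_, ?_⟩
  · intro i hi hik
    have h2 : (0 : ℤ) ≤ (i - 2) * (2 * k - 1 - i) := mul_nonneg (by omega) (by omega)
    linarith
  · intro x q hx hq hqm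
    obtain ⟨t, rfl⟩ := Nat.exists_eq_add_of_le hx
    rw [blockCost, ite_self]
    push_cast at hq hqm ⊢
    obtain rfl | rfl | ht : t = 0 ∨ t = 1 ∨ 2 ≤ t := by omega
    · push_cast at *; linarith
    · push_cast at *; linarith
    · have htR : (2 : ℝ) ≤ t := by exact_mod_cast ht
      have : (q : ℝ) < k * (2 * k + t) + t + j + 1 := by nlinarith
      have : (q : ℤ) < k * (2 * k + t) + t + j + 1 := by exact_mod_cast this
      linarith
  · intro x hx
    obtain ⟨t, rfl⟩ := Nat.exists_eq_add_of_le hx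
    rw [blockCost, ite_self]
    have : 0 ≤ ε * t := by positivity
    push_cast
    linarith
  · intro x hx
    obtain ⟨t, rfl⟩ := Nat.exists_eq_add_of_le hx
    rw [blockCost, ite_self]
    have : ε * t ≤ 1 * t := by gcongr; linarith
    push_cast
    linarith

lemma admissible_of_half_le {k : ℕ} {ε : ℝ} {j : ℤ} (hk : 2 ≤ k) (h0 : 1 / 2 ≤ ε)
    (h1 : ε < 3 / 4) (hj : j ≤ ε * (2 * k - 1)) (hj' : ε * (2 * k - 1) < j + 1) :
    Admissible (k + ε) (2 * k + 1) k (1 - 2 * k + j) 0 := by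
  have hkR : (2 : ℝ) ≤ k := by exact_mod_cast hk
  have hj0 : k - 1 ≤ j := by
    have : (k : ℝ) - 2 < j := by nlinarith
    have : (k : ℤ) - 2 < j := by exact_mod_cast this
    omega
  have hjk : j ≤ 2 * k - 1 := by
    have : (j : ℝ) ≤ 2 * k - 1 := by nlinarith
    exact_mod_cast this
  refine ⟨hk, by omega, by push_cast; linarith, by omega, le_rfl, zero_le_one, ?_, ?_, ?_, ?_⟩
  · intro i hi hik
    obtain rfl | hik : i = 2 * k ∨ i < 2 * k := by omega
    · push_cast; linarith
    · have h2 : (0 : ℤ) ≤ (i - 2) * (2 * k - 1 - i) := mul_nonneg (by omega) (by omega)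
      have : (2 : ℤ) ≤ k := by exact_mod_cast hk
      linarith
  · intro x q hx hq hqm
    obtain ⟨t, rfl⟩ := Nat.exists_eq_add_of_le hx
    rw [blockCost, ite_self]
    push_cast at hq hqm ⊢
    obtain rfl | rfl | ht : t = 0 ∨ t = 1 ∨ 2 ≤ t := by omega
    · push_cast at *; linarith
    · push_cast at *; linarith
    · have htR : (2 : ℝ) ≤ t := by exact_mod_cast ht
      have : (q : ℝ) < k * (2 * k + 1 + t) + 1 + t + j + 1 := by nlinarith
      have : (q : ℤ) < k * (2 * k + 1 + t) + 1 + t + j + 1 := by exact_mod_cast this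
      linarith
  · intro x hx
    obtain ⟨t, rfl⟩ := Nat.exists_eq_add_of_le hx
    rw [blockCost, ite_self]
    have : 0 ≤ ε * t := by positivity
    push_cast
    linarith
  · intro x hx
    obtain ⟨t, rfl⟩ := Nat.exists_eq_add_of_le hx
    rw [blockCost, ite_self]
    have : ε * t ≤ 1 * t := by gcongr; linarith
    push_cast
    linarith

lemma admissible_of_three_quarters_le {k : ℕ} {ε : ℝ} {j : ℤ} (hk : 2 ≤ k) (h0 : 3 / 4 ≤ ε)
    (h1 : ε < 1) (hj : j ≤ ε * (2 * k)) (hj' : ε * (2 * k) < j + 1) :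
    Admissible (k + ε) (2 * k + 1) k (1 - 2 * k + j) 1 := by
  have hkR : (2 : ℝ) ≤ k := by exact_mod_cast hk
  have hj0 : k + 1 ≤ j := by
    have : (k : ℝ) < j := by nlinarith
    have : (k : ℤ) < j := by exact_mod_cast this
    omega
  have hjk : j ≤ 2 * k - 1 := by
    have : (j : ℝ) < 2 * k := by nlinarith
    have : j < 2 * k := by exact_mod_cast this
    omega
  refine ⟨hk, by omega, by push_cast; linarith, by omega, zero_le_one, le_rfl, ?_, ?_, ?_, ?_⟩
  · intro i hi hik
    obtain rfl | hik : i = 2 * k ∨ i < 2 * k := by omega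
    · push_cast; linarith
    · have h2 : (0 : ℤ) ≤ (i - 2) * (2 * k - 1 - i) := mul_nonneg (by omega) (by omega)
      have : (2 : ℤ) ≤ k := by exact_mod_cast hk
      linarith
  · intro x q hx hq hqm
    obtain ⟨t, rfl⟩ := Nat.exists_eq_add_of_le hx
    obtain rfl | ht := Nat.eq_zero_or_pos t
    · rw [blockCost, if_pos (by simp)]
      push_cast at *
      linarith
    · rw [blockCost, if_neg (by omega)]
      push_cast at hq hqm ⊢
      have htR : (1 : ℝ) ≤ t := by exact_mod_cast ht
      have : (q : ℝ) < k * (2 * k + 1 + t) + 1 + t + j + 1 := by nlinarith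
      have : (q : ℤ) < k * (2 * k + 1 + t) + 1 + t + j + 1 := by exact_mod_cast this
      linarith
  · intro x hx
    obtain ⟨t, rfl⟩ := Nat.exists_eq_add_of_le hx
    obtain rfl | ht := Nat.eq_zero_or_pos t
    · rw [blockCost, if_pos (by simp)]
      push_cast
      linarith
    · rw [blockCost, if_neg (by omega)]
      have htR : (1 : ℝ) ≤ t := by exact_mod_cast ht
      have : ε * 1 ≤ ε * t := by gcongr
      push_cast
      linarith
  · intro x hx
    obtain ⟨t, rfl⟩ := Nat.exists_eq_add_of_le hx
    have : ε * t ≤ 1 * t := by gcongr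
    rw [blockCost]
    split_ifs <;> push_cast <;> linarith

lemma exists_admissible {m : ℝ} (hm : 2 ≤ m) : ∃ N k d δ, Admissible m N k d δ := by
  have hk : 2 ≤ ⌊m⌋₊ := Nat.le_floor (by exact_mod_cast hm)
  have h0 := Nat.floor_le (by linarith : 0 ≤ m)
  have h1 := Nat.lt_floor_add_one m
  obtain ⟨ε, hε⟩ : ∃ ε, m = ⌊m⌋₊ + ε := ⟨m - ⌊m⌋₊, by ring⟩
  generalize ⌊m⌋₊ = k at *
  subst hε
  obtain h | h := lt_or_ge ε (1 / 2)
  · exact ⟨_, _, _, _, admissible_of_lt_half hk (by linarith) h (Int.floor_le _)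
      (Int.lt_floor_add_one _)⟩
  obtain h' | h' := lt_or_ge ε (3 / 4)
  · exact ⟨_, _, _, _, admissible_of_half_le hk h h' (Int.floor_le _) (Int.lt_floor_add_one _)⟩
  · exact ⟨_, _, _, _, admissible_of_three_quarters_le hk h' (by linarith) (Int.floor_le _)
      (Int.lt_floor_add_one _)⟩

end Parameters

section SparsePartition

variable {α V : Type*} [DecidableEq α] [DecidableEq V] {ends : α → Finset V}

lemma Cover.card_le_of_forall_cover {B : Finset α → ℤ → Prop} (hs : ∀ e, B {e} 1) {I Q : Finset α}
    {c : ℤ} (hI : ∀ a, Cover B I a → (I.card : ℤ) ≤ a) (hQI : Q ⊆ I) (hQ : B Q c) :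
    (Q.card : ℤ) ≤ c := by
  have h := hI _ (by
    simpa [Finset.sdiff_union_of_subset hQI] using
      Cover.union (Cover.of_singletons hs (I \ Q)) hQ Finset.sdiff_disjoint)
  have := Finset.card_sdiff_add_card_eq_card hQI
  omega

/-- The partition into a forest and a sparse part, in terms of edge sets. -/
lemma exists_forest_sparse_partition {m : ℝ} (hm : 2 ≤ m) (h₂ : ∀ e, (ends e).card = 2)
    (hinj : Function.Injective ends) (hX : ∀ X, (X.card : ℝ) ≤ m * (edgeSupport ends X).card)
    (E : Finset α) :
    ∃ I₁ I₂ : Finset α, I₁ ∪ I₂ = E ∧ Disjoint I₁ I₂ ∧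
      (∀ Q ⊆ I₁, Q.Nonempty → (Q.card : ℝ) ≤ (edgeSupport ends Q).card - 1) ∧
      ∀ Q ⊆ I₂, Q.Nonempty → (Q.card : ℝ) ≤ m * ((edgeSupport ends Q).card - 2) + 1 := by
  obtain ⟨N, k, d, δ, h⟩ := exists_admissible hm
  have hs₁ : ∀ e, ForestBlock ends {e} 1 := ForestBlock.singleton h₂
  have hs₂ : ∀ e, SparseBlock ends N k d δ {e} 1 := SparseBlock.singleton N k d δ
  obtain ⟨I₁, I₂, hE, hd, hI⟩ := exists_partition_of_card_le_cover
    (ForestBlock.uncrossing (ends := ends)) (h.uncrossing h₂ hinj) E (by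
      intro X _ a b ha hb
      obtain ⟨n, hn, hXn⟩ := ha.exists_vertexDisjointCover
      linarith [h.card_le_of_covers h₂ hinj hX hXn b hb])
  refine ⟨I₁, I₂, hE, hd, fun Q hQ hne => ?_, fun Q hQ hne => ?_⟩
  · have : (Q.card : ℤ) ≤ (edgeSupport ends Q).card - 1 :=
      Cover.card_le_of_forall_cover hs₁
        (fun a ha => by linarith [hI a _ ha (Cover.of_singletons hs₂ I₂)]) hQ ⟨hne, rfl⟩
    exact_mod_cast this
  · by_cases hN : N ≤ (edgeSupport ends Q).card
    · have : (Q.card : ℤ) ≤ blockCost N k d δ (edgeSupport ends Q).card :=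
        Cover.card_le_of_forall_cover hs₂
          (fun b hb => by linarith [hI _ b (Cover.of_singletons hs₁ I₁) hb]) hQ (Or.inr ⟨hN, rfl⟩)
      have : (Q.card : ℝ) ≤ blockCost N k d δ (edgeSupport ends Q).card := by exact_mod_cast this
      exact this.trans (h.cost_le _ hN)
    · have h₃ : 2 * (Q.card : ℝ) ≤ (edgeSupport ends Q).card * ((edgeSupport ends Q).card - 1) := by
        exact_mod_cast two_mul_card_le h₂ hinj Q
      have h₄ : (2 : ℝ) ≤ (edgeSupport ends Q).card := by
        exact_mod_cast two_le_card_edgeSupport h₂ hne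
      have h₅ : ((edgeSupport ends Q).card : ℝ) + 1 ≤ N := by exact_mod_cast (by omega)
      nlinarith [h.le_two_mul]

lemma IsSparse.of_edgeSupport {V : Type*} [Fintype V] [DecidableEq V] {G G' : SimpleGraph V}
    {a b : ℝ} (ha : 0 ≤ a) {I : Finset G.edgeSet}
    (hI : ∀ Q ⊆ I, Q.Nonempty →
      (Q.card : ℝ) ≤ a * (edgeSupport (fun e : G.edgeSet => e.1.toFinset) Q).card + b)
    (hG' : G'.edgeSet = Subtype.val '' (I : Set G.edgeSet)) : IsSparse G' a b := by
  classical
  intro H hH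
  have hsub : ∀ e ∈ H.edgeSet, ∃ f ∈ I, f.1 = e := fun e he => by
    simpa [hG'] using H.edgeSet_subset he
  set Q : Finset G.edgeSet := I.filter fun e => e.1 ∈ H.edgeSet with hQ
  have hQH : Subtype.val '' (Q : Set G.edgeSet) = H.edgeSet := by
    ext e
    constructor
    · rintro ⟨f, hf, rfl⟩
      exact (Finset.mem_filter.1 hf).2
    · intro he
      obtain ⟨f, hf, rfl⟩ := hsub e he
      exact ⟨f, Finset.mem_filter.2 ⟨hf, he⟩, rfl⟩
  have hcard : H.edgeSet.ncard = Q.card := by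
    rw [← hQH, Set.ncard_image_of_injective _ Subtype.val_injective, Set.ncard_coe_finset]
  have hne : Q.Nonempty := by
    rw [← hQH] at hH
    exact_mod_cast hH.of_image
  have hverts : (edgeSupport (fun e : G.edgeSet => e.1.toFinset) Q).card ≤ H.verts.ncard := by
    rw [← Set.ncard_coe_finset]
    refine Set.ncard_le_ncard (fun v hv => ?_) (Set.toFinite _)
    obtain ⟨e, he, hv⟩ := Finset.mem_biUnion.1 (Finset.mem_coe.1 hv)
    exact H.mem_verts_of_mem_edge (Finset.mem_filter.1 he).2 (Sym2.mem_toFinset.1 hv)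
  rw [hcard]
  have : ((edgeSupport (fun e : G.edgeSet => e.1.toFinset) Q).card : ℝ) ≤ H.verts.ncard := by
    exact_mod_cast hverts
  linarith [hI Q (Finset.filter_subset _ _) hne, mul_le_mul_of_nonneg_left this ha]

end SparsePartition

theorem stmt13 (m : ℝ) (hm : 2 ≤ m)
    {V : Type*} [Fintype V] (G : SimpleGraph V)
    (hG : IsSparse G m 0) :
    HasSparsePartition G 1 (-1) m (1 - 2 * m) := by
  classical
  set ends : G.edgeSet → Finset V := fun e => e.1.toFinset with hends
  have h₂ : ∀ e, (ends e).card = 2 := fun e =>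
    Sym2.card_toFinset_of_not_isDiag _ (G.not_isDiag_of_mem_edgeSet e.2)
  have hinj : Function.Injective ends := fun e f h => by
    refine Subtype.ext (Sym2.ext fun v => ?_)
    rw [← Sym2.mem_toFinset, ← Sym2.mem_toFinset]
    exact Finset.ext_iff.1 h v
  have hX : ∀ X, (X.card : ℝ) ≤ m * (edgeSupport ends X).card := by
    intro X
    obtain rfl | hne := X.eq_empty_or_nonempty
    · simp [edgeSupport]
    let H : G.Subgraph :=
      { verts := edgeSupport ends X
        Adj := fun v w => ∃ e ∈ X, e.1 = s(v, w)
        adj_sub := by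
          rintro v w ⟨e, -, he⟩
          exact (G.mem_edgeSet).1 (he ▸ e.2)
        edge_vert := by
          rintro v w ⟨e, heX, he⟩
          exact Finset.mem_coe.2 (Finset.mem_biUnion.2 ⟨e, heX, by simp [hends, he]⟩)
        symm := ⟨fun v w ⟨e, heX, he⟩ => ⟨e, heX, by rw [he, Sym2.eq_swap]⟩⟩ }
    have hH : H.edgeSet = Subtype.val '' (X : Set G.edgeSet) := by
      ext e
      induction e with
      | h v w => simp [H]
    have := hG H (by rw [hH]; exact (Finset.coe_nonempty.2 hne).image _)
    rw [hH, Set.ncard_image_of_injective _ Subtype.val_injective, Set.ncard_coe_finset] at this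
    simpa [H, Set.ncard_coe_finset] using this
  obtain ⟨I₁, I₂, hU, hd, hI₁, hI₂⟩ := exists_forest_sparse_partition hm h₂ hinj hX Finset.univ
  have hedge : ∀ I : Finset G.edgeSet,
      (SimpleGraph.fromEdgeSet (Subtype.val '' (I : Set G.edgeSet))).edgeSet =
        Subtype.val '' (I : Set G.edgeSet) := by
    intro I
    rw [SimpleGraph.edgeSet_fromEdgeSet, sdiff_eq_left, Set.disjoint_left]
    rintro _ ⟨e, -, rfl⟩
    exact G.not_isDiag_of_mem_edgeSet e.2
  refine ⟨.fromEdgeSet (Subtype.val '' (I₁ : Set G.edgeSet)),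
    .fromEdgeSet (Subtype.val '' (I₂ : Set G.edgeSet)), ?_, ?_, ?_, ?_, ?_, ?_⟩
  · rw [← SimpleGraph.edgeSet_subset_edgeSet, hedge]
    exact Subtype.coe_image_subset _ _
  · rw [← SimpleGraph.edgeSet_subset_edgeSet, hedge]
    exact Subtype.coe_image_subset _ _
  · rw [hedge, hedge, ← Set.image_union, ← Finset.coe_union, hU]
    simp
  · rw [hedge, hedge, Set.disjoint_image_iff Subtype.val_injective]
    exact_mod_cast hd
  · exact IsSparse.of_edgeSupport zero_le_one
      (fun Q hQ hne => by linarith [hI₁ Q hQ hne]) (hedge I₁)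
  · exact IsSparse.of_edgeSupport (by linarith)
      (fun Q hQ hne => by linarith [hI₂ Q hQ hne]) (hedge I₂)
end

section
/- Let a, b be real numbers with a ≥ −b ≥ 0, and let G be an (a,b)-sparse finite simple graph. If H₁ and H₂ are (a,b)-tight subgraphs of G that share at least one vertex, then the union H₁ ∪ H₂ (with vertex set V(H₁) ∪ V(H₂) and edge set E(H₁) ∪ E(H₂)) is an (a,b)-tight subgraph of G. -/
/-- A subgraph `H` of `G` is `(a,b)`-sparse if every subgraph `H'` of `H`
containing at least one edge satisfies `e(H') ≤ a * v(H') + b`. -/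
def SubgraphIsSparse {V : Type*} [Fintype V] {G : SimpleGraph V}
    (H : G.Subgraph) (a b : ℝ) : Prop :=
  ∀ H' : G.Subgraph, H' ≤ H → H'.edgeSet.Nonempty →
    (H'.edgeSet.ncard : ℝ) ≤ a * H'.verts.ncard + b

/-- A nonempty subgraph `H` of `G` is `(a,b)`-tight if it is `(a,b)`-sparse and
moreover `e(H) = a * v(H) + b`. -/
def SubgraphIsTight {V : Type*} [Fintype V] {G : SimpleGraph V}
    (H : G.Subgraph) (a b : ℝ) : Prop :=
  H.verts.Nonempty ∧ SubgraphIsSparse H a b ∧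
    (H.edgeSet.ncard : ℝ) = a * H.verts.ncard + b

/-- In the range `0 ≤ -b ≤ a`, the sparsity bound extends to edgeless subgraphs with a vertex. -/
theorem IsSparse.ncard_edgeSet_le {V : Type*} [Fintype V] {G : SimpleGraph V} {a b : ℝ}
    (hG : IsSparse G a b) (hba : -b ≤ a) (hb : 0 ≤ -b) {H : G.Subgraph}
    (hH : H.verts.Nonempty) : (H.edgeSet.ncard : ℝ) ≤ a * H.verts.ncard + b := by
  rcases H.edgeSet.eq_empty_or_nonempty with he | he
  · have hv : (1 : ℝ) ≤ H.verts.ncard := by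
      exact_mod_cast (Set.ncard_pos (Set.toFinite _)).2 hH
    rw [he, Set.ncard_empty, Nat.cast_zero]
    nlinarith
  · exact hG H he

theorem stmt14 (a b : ℝ) (hba : -b ≤ a) (hb : 0 ≤ -b)
    {V : Type*} [Fintype V] (G : SimpleGraph V) (hG : IsSparse G a b)
    (H₁ H₂ : G.Subgraph)
    (h₁ : SubgraphIsTight H₁ a b) (h₂ : SubgraphIsTight H₂ a b)
    (hmeet : (H₁.verts ∩ H₂.verts).Nonempty) :
    SubgraphIsTight (H₁ ⊔ H₂) a b := by
  have hne : (H₁ ⊔ H₂).verts.Nonempty := h₁.1.mono Set.subset_union_left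
  refine ⟨hne, fun H _ hH => hG H hH, le_antisymm (hG.ncard_edgeSet_le hba hb hne) ?_⟩
  have hinf := hG.ncard_edgeSet_le hba hb (H := H₁ ⊓ H₂) hmeet
  have hv : ((H₁ ⊔ H₂).verts.ncard : ℝ) + (H₁ ⊓ H₂).verts.ncard
      = H₁.verts.ncard + H₂.verts.ncard := by
    exact_mod_cast Set.ncard_union_add_ncard_inter H₁.verts H₂.verts
  have he : ((H₁ ⊔ H₂).edgeSet.ncard : ℝ) + (H₁ ⊓ H₂).edgeSet.ncard
      = H₁.edgeSet.ncard + H₂.edgeSet.ncard := by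
    rw [SimpleGraph.Subgraph.edgeSet_sup, SimpleGraph.Subgraph.edgeSet_inf]
    exact_mod_cast Set.ncard_union_add_ncard_inter H₁.edgeSet H₂.edgeSet
      (Set.toFinite _) (Set.toFinite _)
  linear_combination hinf + a * hv - he - h₁.2.2 - h₂.2.2
end
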